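/- Let β > 2, let p, d be positive integers, let H > 0, and let f : [0,1]^d → ℝ^p belong to the Hölder ball H^β([0,1]^d, H). Then for every integer K ≥ 2 there exists a ReQU network h_f : [0,1]^d → ℝ^p whose width is at most max{4d(K+⌊β⌋)^d, 12(K+2⌊β⌋+1), p}, which has exactly 6 + 2(⌊β⌋−2) + ⌈log₂ d⌉ + 2·max{⌈max{log₂(2d⌊β⌋+d), log₂ log₂ H}⌉, 1} hidden layers (where log₂ log₂ H is interpreted as 0 whenever H ≤ 2), whose weights all lie in [−1,1], and which has at most p(K+⌊β⌋)^d · C(β,d,H) nonzero weights, where C(β,d,H) = 60·max{⌈max{log₂(2d⌊β⌋+d), log₂ log₂ H}⌉, 1} + 38 + 20d² + 144d⌊β⌋ + 8d, such that for every ℓ ∈ {0, 1, …, ⌊β⌋}: ‖f − h_f‖_{H^ℓ([0,1]^d)} ≤ (√2·e·d)^β H / K^{β−ℓ} + 9^{d(⌊β⌋−1)} (2⌊β⌋+1)^{2d+ℓ} (√2·e·d)^β H / K^{β−ℓ}. -/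

import Mathlib

open scoped BigOperators Classical

noncomputable def requ (t : ℝ) : ℝ := (max t 0) ^ 2

structure ReQUNet where
  L : ℕ
  arch : ℕ → ℕ
  W : ℕ → ℕ → ℕ → ℝ
  v : ℕ → ℕ → ℝ

namespace ReQUNet

noncomputable def hidden (N : ReQUNet) (x : ℕ → ℝ) : ℕ → ℕ → ℝ
  | 0, j => ∑ k ∈ Finset.range (N.arch 0), N.W 0 j k * x k
  | i + 1, j =>
      ∑ k ∈ Finset.range (N.arch (i + 1)),
        N.W (i + 1) j k * requ (N.hidden x i k - N.v (i + 1) k)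

noncomputable def eval (N : ReQUNet) (x : ℕ → ℝ) : ℕ → ℝ := N.hidden x N.L

noncomputable def evalVec (N : ReQUNet) (d : ℕ) (x : Fin d → ℝ) : ℕ → ℝ :=
  N.eval fun k => if h : k < d then x ⟨k, h⟩ else 0

def width (N : ReQUNet) : ℕ := (Finset.range (N.L + 2)).sup N.arch

def weightsIn (N : ReQUNet) (s : Set ℝ) : Prop :=
  (∀ i ≤ N.L, ∀ j < N.arch (i + 1), ∀ k < N.arch i, N.W i j k ∈ s) ∧
  ∀ i, 1 ≤ i → i ≤ N.L → ∀ j < N.arch i, N.v i j ∈ s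

noncomputable def numNonzero (N : ReQUNet) : ℕ :=
  (∑ i ∈ Finset.range (N.L + 1),
    ((Finset.range (N.arch (i + 1)) ×ˢ Finset.range (N.arch i)).filter
      fun p => N.W i p.1 p.2 ≠ 0).card) +
  ∑ i ∈ Finset.Icc 1 N.L,
    ((Finset.range (N.arch i)).filter fun j => N.v i j ≠ 0).card

end ReQUNet

noncomputable def pderiv1 {d : ℕ} (i : Fin d) (g : (Fin d → ℝ) → ℝ) : (Fin d → ℝ) → ℝ :=
  fun x => fderiv ℝ g x (Pi.single i 1)

noncomputable def mderiv {d : ℕ} (γ : Fin d → ℕ) (g : (Fin d → ℝ) → ℝ) : (Fin d → ℝ) → ℝ :=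
  (List.finRange d).foldr (fun i h => (pderiv1 i)^[γ i] h) g

noncomputable def eucDist {d : ℕ} (x y : Fin d → ℝ) : ℝ :=
  Real.sqrt (∑ i, (x i - y i) ^ 2)

def cube (d : ℕ) : Set (Fin d → ℝ) := Set.Icc 0 1

def cubeHO (d : ℕ) : Set (Fin d → ℝ) := Set.Ico 0 1

def HolderNormLeOn {d : ℕ} (Ω : Set (Fin d → ℝ)) : ℕ → ((Fin d → ℝ) → ℝ) → ℝ → Prop
  | 0, g, E => ∀ x ∈ Ω, |g x| ≤ E
  | m + 1, g, E =>
      (∀ γ : Fin d → ℕ, (∑ i, γ i) ≤ m → ∀ x ∈ Ω, |mderiv γ g x| ≤ E) ∧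
      ∀ γ : Fin d → ℕ, (∑ i, γ i) = m → ∀ x ∈ Ω, ∀ y ∈ Ω, x ≠ y →
        |mderiv γ g x - mderiv γ g y| ≤ E * min 1 (eucDist x y)

def VHolderNormLe {d : ℕ} (p ℓ : ℕ) (f : (Fin d → ℝ) → Fin p → ℝ) (E : ℝ) : Prop :=
  ∀ i : Fin p, HolderNormLeOn (cube d) ℓ (fun x => f x i) E

noncomputable def lfloor (β : ℝ) : ℕ := ⌈β⌉₊ - 1

def MemHolderBall {d : ℕ} (p : ℕ) (β H : ℝ) (f : (Fin d → ℝ) → Fin p → ℝ) : Prop :=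
  (∀ i : Fin p, ContDiff ℝ (lfloor β : ℕ∞) fun x => f x i) ∧
  (∀ i : Fin p, ∀ γ : Fin d → ℕ, (∑ j, γ j) ≤ lfloor β →
      ∀ x ∈ cube d, |mderiv γ (fun y => f y i) x| ≤ H) ∧
  ∀ i : Fin p, ∀ γ : Fin d → ℕ, (∑ j, γ j) = lfloor β →
      ∀ x ∈ cube d, ∀ y ∈ cube d, x ≠ y →
        |mderiv γ (fun z => f z i) x - mderiv γ (fun z => f z i) y| ≤
          H * min 1 (eucDist x y) ^ (β - (lfloor β : ℝ))

def MemHolderBall1 {d : ℕ} (β H : ℝ) (f : (Fin d → ℝ) → ℝ) : Prop :=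
  (ContDiff ℝ (lfloor β : ℕ∞) f) ∧
  (∀ γ : Fin d → ℕ, (∑ j, γ j) ≤ lfloor β → ∀ x ∈ cube d, |mderiv γ f x| ≤ H) ∧
  ∀ γ : Fin d → ℕ, (∑ j, γ j) = lfloor β →
      ∀ x ∈ cube d, ∀ y ∈ cube d, x ≠ y →
        |mderiv γ f x - mderiv γ f y| ≤ H * min 1 (eucDist x y) ^ (β - (lfloor β : ℝ))

noncomputable def loglog2 (H : ℝ) : ℝ := if H ≤ 2 then 0 else Real.logb 2 (Real.logb 2 H)

noncomputable def knot (q K j : ℕ) : ℝ :=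
  if j ≤ q + 1 then 0 else if j ≤ q + K then ((j - (q + 1) : ℕ) : ℝ) / K else 1

noncomputable def Bspl (q K : ℕ) : ℕ → ℕ → ℝ → ℝ
  | 0, j, x =>
      if knot q K j < knot q K (j + 1) ∧ knot q K j ≤ x ∧ x < knot q K (j + 1) then
        1 / (knot q K (j + 1) - knot q K j)
      else 0
  | m + 1, j, x =>
      if knot q K j < knot q K (j + m + 2) ∧ knot q K j ≤ x ∧ x < knot q K (j + m + 2) then
        ((x - knot q K j) * Bspl q K m j x
            + (knot q K (j + m + 2) - x) * Bspl q K m (j + 1) x) /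
          (knot q K (j + m + 2) - knot q K j)
      else 0

noncomputable def Nspl (q K m j : ℕ) (x : ℝ) : ℝ :=
  (knot q K (j + m + 1) - knot q K j) * Bspl q K m j x

def QRanalytic {d : ℕ} (p : ℕ) (Q R : ℝ) (f : (Fin d → ℝ) → Fin p → ℝ) : Prop :=
  (∀ i : Fin p, ContDiff ℝ (⊤ : ℕ∞) fun x => f x i) ∧
  ∀ s : ℕ, VHolderNormLe p s f (Q * ((R : ℝ) ^ s)⁻¹ * (Nat.factorial s : ℝ))

def archSpec (q K i : ℕ) : ℕ :=
  if i = 0 then 1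
  else if i = 1 then 4 * (K + 2 * q - 1) + K
  else if i ≤ 4 then 4 * K + 8 * q
  else if i ≤ 4 + 2 * (q - 2) then
    (if (i - 5) % 2 = 0 then 12 * (K + 2 * q - (3 + (i - 5) / 2)) + 12
      else 8 * (K + 2 * q - (3 + (i - 5) / 2)) + 8)
  else K + q + 2

namespace SplineApprox

/-- A family of functions indexed by multi-indices that is closed under partial derivatives up to
total order `n`. -/
def IsJet {d : ℕ} (n : ℕ) (G : (Fin d → ℕ) → (Fin d → ℝ) → ℝ) : Prop :=
  ∀ γ : Fin d → ℕ, ∑ i, γ i < n → ∀ x, HasFDerivAt (G γ)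
    (∑ i, G (γ + Pi.single i 1) x •
      (ContinuousLinearMap.proj i : (Fin d → ℝ) →L[ℝ] ℝ)) x

theorem IsJet.sub {d n m : ℕ} {G F : (Fin d → ℕ) → (Fin d → ℝ) → ℝ} (hG : IsJet n G)
    (hF : IsJet m F) (hmn : m ≤ n) : IsJet m fun γ x => G γ x - F γ x := by
  intro γ hγ x
  refine ((hG γ (hγ.trans_le hmn) x).sub (hF γ hγ x)).congr_fderiv ?_
  rw [← Finset.sum_sub_distrib]
  exact Finset.sum_congr rfl fun i _ => (sub_smul (G (γ + Pi.single i 1) x) _ _).symm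

theorem IsJet.pderiv1_eq {d n : ℕ} {G : (Fin d → ℕ) → (Fin d → ℝ) → ℝ} (hG : IsJet n G)
    {γ : Fin d → ℕ} (hγ : ∑ i, γ i < n) (i : Fin d) :
    pderiv1 i (G γ) = G (γ + Pi.single i 1) := by
  funext x
  rw [pderiv1, (hG γ hγ x).fderiv]
  simp [Pi.single_apply]

theorem sum_add_single {d : ℕ} (γ : Fin d → ℕ) (i : Fin d) (k : ℕ) :
    ∑ j, (γ + Pi.single i k : Fin d → ℕ) j = ∑ j, γ j + k := by
  simp [Finset.sum_add_distrib]

theorem IsJet.iterate_pderiv1_eq {d n : ℕ} {G : (Fin d → ℕ) → (Fin d → ℝ) → ℝ}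
    (hG : IsJet n G) {γ : Fin d → ℕ} (i : Fin d) (k : ℕ) (hγ : ∑ i, γ i + k ≤ n) :
    (pderiv1 i)^[k] (G γ) = G (γ + Pi.single i k) := by
  induction k with
  | zero => simp
  | succ k ih =>
    rw [Function.iterate_succ_apply', ih (by omega), hG.pderiv1_eq (by rw [sum_add_single]; omega),
      add_assoc, ← Pi.single_add]

theorem IsJet.mderiv_eq {d n : ℕ} {G : (Fin d → ℕ) → (Fin d → ℝ) → ℝ} (hG : IsJet n G)
    {γ : Fin d → ℕ} (hγ : ∑ i, γ i ≤ n) : mderiv γ (G 0) = G γ := by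
  have key : ∀ l : List (Fin d), l.Nodup →
      l.foldr (fun i h => (pderiv1 i)^[γ i] h) (G 0) = G fun i => if i ∈ l then γ i else 0 := by
    intro l
    induction l with
    | nil => intro _; simp; rfl
    | cons a l ih =>
      intro hl
      rw [List.nodup_cons] at hl
      have e : ((fun i => if i ∈ l then γ i else 0) + Pi.single a (γ a) : Fin d → ℕ) =
          fun i => if i ∈ a :: l then γ i else 0 := by
        funext i
        by_cases h : i = a
        · subst h; simp [hl.1]
        · simp [h]
      rw [List.foldr_cons, ih hl.2, hG.iterate_pderiv1_eq, e]
      rw [← sum_add_single, e]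
      refine le_trans (Finset.sum_le_sum fun i _ => ?_) hγ
      split_ifs <;> simp
  rw [mderiv, key _ (List.nodup_finRange d)]
  simp

theorem contDiff_pderiv1 {d n : ℕ} {g : (Fin d → ℝ) → ℝ} (hg : ContDiff ℝ ((n + 1 : ℕ) : ℕ∞) g)
    (i : Fin d) : ContDiff ℝ (n : ℕ∞) (pderiv1 i g) := by
  have h : ContDiff ℝ (n : ℕ∞) (fderiv ℝ g) := hg.fderiv_right (by norm_cast)
  exact h.clm_apply contDiff_const

theorem pderiv1_comm {d : ℕ} {g : (Fin d → ℝ) → ℝ} (hg : ContDiff ℝ ((2 : ℕ) : ℕ∞) g)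
    (i j : Fin d) : pderiv1 i (pderiv1 j g) = pderiv1 j (pderiv1 i g) := by
  have hd : Differentiable ℝ (fderiv ℝ g) := by
    have h : ContDiff ℝ ((1 : ℕ) : ℕ∞) (fderiv ℝ g) := hg.fderiv_right (by norm_cast)
    exact h.differentiable (by norm_num)
  have key : ∀ v w x, fderiv ℝ (fun y => fderiv ℝ g y v) x w = fderiv ℝ (fderiv ℝ g) x w v := by
    intro v w x
    rw [fderiv_clm_apply (hd x) (differentiableAt_const v)]
    simp
  funext x
  have hs : IsSymmSndFDerivAt ℝ g x :=
    hg.contDiffAt.isSymmSndFDerivAt (by rw [minSmoothness_of_isRCLikeNormedField]; norm_cast)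
  change fderiv ℝ (fun y => fderiv ℝ g y _) x _ = fderiv ℝ (fun y => fderiv ℝ g y _) x _
  rw [key, key]
  exact hs _ _

theorem contDiff_iterate_pderiv1 {d n k : ℕ} {g : (Fin d → ℝ) → ℝ}
    (hg : ContDiff ℝ ((n + k : ℕ) : ℕ∞) g) (i : Fin d) :
    ContDiff ℝ (n : ℕ∞) ((pderiv1 i)^[k] g) := by
  induction k generalizing g with
  | zero => exact hg
  | succ k ih =>
    rw [Function.iterate_succ_apply]
    exact ih (contDiff_pderiv1 hg i)

theorem contDiff_foldr_pderiv1 {d : ℕ} (γ : Fin d → ℕ) (l : List (Fin d)) {n : ℕ}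
    {g : (Fin d → ℝ) → ℝ} (hg : ContDiff ℝ ((n + (l.map γ).sum : ℕ) : ℕ∞) g) :
    ContDiff ℝ (n : ℕ∞) (l.foldr (fun i h => (pderiv1 i)^[γ i] h) g) := by
  induction l generalizing n with
  | nil => simpa using hg
  | cons a l ih =>
    rw [List.foldr_cons]
    refine contDiff_iterate_pderiv1 (ih ?_) a
    rwa [List.map_cons, List.sum_cons, ← add_assoc] at hg

theorem pderiv1_iterate_comm {d k : ℕ} {g : (Fin d → ℝ) → ℝ}
    (hg : ContDiff ℝ ((k + 1 : ℕ) : ℕ∞) g) (i j : Fin d) :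
    pderiv1 i ((pderiv1 j)^[k] g) = (pderiv1 j)^[k] (pderiv1 i g) := by
  induction k generalizing g with
  | zero => rfl
  | succ k ih =>
    rw [Function.iterate_succ_apply, Function.iterate_succ_apply, ih (contDiff_pderiv1 hg j),
      pderiv1_comm (hg.of_le (by norm_cast; omega))]

theorem pderiv1_foldr {d : ℕ} (γ : Fin d → ℕ) (i : Fin d) (l : List (Fin d)) (hl : l.Nodup)
    (hi : i ∈ l) {g : (Fin d → ℝ) → ℝ} (hg : ContDiff ℝ (((l.map γ).sum + 1 : ℕ) : ℕ∞) g) :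
    pderiv1 i (l.foldr (fun i h => (pderiv1 i)^[γ i] h) g) =
      l.foldr (fun j h => (pderiv1 j)^[(γ + Pi.single i 1 : Fin d → ℕ) j] h) g := by
  induction l with
  | nil => simp at hi
  | cons a l ih =>
    rw [List.nodup_cons] at hl
    rw [List.map_cons, List.sum_cons] at hg
    rw [List.foldr_cons, List.foldr_cons]
    by_cases h : i = a
    · subst h
      have e : l.foldr (fun j h => (pderiv1 j)^[(γ + Pi.single i 1 : Fin d → ℕ) j] h) g =
          l.foldr (fun j h => (pderiv1 j)^[γ j] h) g := by
        refine List.foldr_ext _ _ _ fun j hj b => ?_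
        have : j ≠ i := fun h => hl.1 (h ▸ hj)
        simp [this]
      have e' : (γ + Pi.single i 1 : Fin d → ℕ) i = γ i + 1 := by simp
      rw [e, e', Function.iterate_succ_apply']
    · rw [pderiv1_iterate_comm, ih hl.2 ((List.mem_cons.1 hi).resolve_left h)
        (hg.of_le (by norm_cast; omega))]
      · have : a ≠ i := fun h' => h h'.symm
        simp [this]
      · refine contDiff_foldr_pderiv1 γ l ?_
        rwa [show γ a + 1 + (l.map γ).sum = γ a + (l.map γ).sum + 1 by omega]

theorem isJet_mderiv {d n : ℕ} {g : (Fin d → ℝ) → ℝ} (hg : ContDiff ℝ (n : ℕ∞) g) :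
    IsJet n fun γ => mderiv γ g := by
  intro γ hγ x
  have hsum : ((List.finRange d).map γ).sum = ∑ i, γ i := by
    rw [← List.ofFn_eq_map, List.sum_ofFn]
  have hc : ContDiff ℝ ((1 : ℕ) : ℕ∞) (mderiv γ g) :=
    contDiff_foldr_pderiv1 γ _ (hg.of_le (by rw [hsum]; norm_cast; omega))
  have hd : DifferentiableAt ℝ (mderiv γ g) x := hc.differentiable (by norm_num) x
  refine hd.hasFDerivAt.congr_fderiv ?_
  have hp : ∀ i, mderiv (γ + Pi.single i 1) g x = fderiv ℝ (mderiv γ g) x (Pi.single i 1) := by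
    intro i
    have := pderiv1_foldr γ i (List.finRange d) (List.nodup_finRange d) (List.mem_finRange i)
      (g := g) (hg.of_le (by rw [hsum]; norm_cast))
    exact (congrFun this x).symm
  refine ContinuousLinearMap.coe_injective ((Pi.basisFun ℝ (Fin d)).ext fun i => ?_)
  simp [hp, Pi.single_apply]

/-- The truncated power `x₊ᵏ / k!`, right-continuous for `k = 0`. -/
noncomputable def tpow (k : ℕ) (x : ℝ) : ℝ := if 0 ≤ x then x ^ k / k.factorial else 0

theorem tpow_of_neg {k : ℕ} {x : ℝ} (hx : x < 0) : tpow k x = 0 := by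
  simp [tpow, not_le.2 hx]

theorem tpow_of_nonneg {k : ℕ} {x : ℝ} (hx : 0 ≤ x) : tpow k x = x ^ k / k.factorial := by
  simp [tpow, hx]

theorem succ_mul_tpow_succ (k : ℕ) (x : ℝ) : ((k : ℝ) + 1) * tpow (k + 1) x = x * tpow k x := by
  unfold tpow
  split_ifs
  · rw [Nat.factorial_succ]
    have : (k.factorial : ℝ) ≠ 0 := by positivity
    have : (k : ℝ) + 1 ≠ 0 := by positivity
    push_cast
    field_simp
    ring
  · simp

theorem tpow_mul {a : ℝ} (ha : 0 < a) (k : ℕ) (x : ℝ) : tpow k (a * x) = a ^ k * tpow k x := by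
  unfold tpow
  simp only [mul_nonneg_iff_of_pos_left ha]
  split_ifs
  · rw [mul_pow, mul_div_assoc]
  · simp

theorem tpow_eq_max_pow {k : ℕ} (hk : k ≠ 0) (x : ℝ) :
    tpow k x = (max x 0) ^ k / k.factorial := by
  unfold tpow
  split_ifs with h
  · rw [max_eq_left h]
  · rw [max_eq_right (not_le.1 h).le, zero_pow hk, zero_div]

theorem continuous_tpow {k : ℕ} (hk : k ≠ 0) : Continuous (tpow k) := by
  have : tpow k = fun x : ℝ => (max x 0) ^ k / (k.factorial : ℝ) := funext (tpow_eq_max_pow hk)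
  rw [this]
  fun_prop

theorem hasDerivAt_pow_div_factorial (k : ℕ) (x : ℝ) :
    HasDerivAt (fun y : ℝ => y ^ (k + 1) / (k + 1).factorial) (x ^ k / k.factorial) x := by
  have h := (hasDerivAt_pow (k + 1) x).div_const ((k + 1).factorial : ℝ)
  refine h.congr_deriv ?_
  rw [Nat.factorial_succ]
  have : (k.factorial : ℝ) ≠ 0 := by positivity
  have : (k : ℝ) + 1 ≠ 0 := by positivity
  push_cast
  field_simp

theorem hasDerivWithinAt_tpow_right (k : ℕ) (x : ℝ) :
    HasDerivWithinAt (tpow (k + 1)) (tpow k x) (Set.Ici x) x := by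
  rcases lt_or_ge x 0 with hx | hx
  · rw [tpow_of_neg hx]
    refine HasDerivAt.hasDerivWithinAt ?_
    refine (hasDerivAt_const x (0 : ℝ)).congr_of_eventuallyEq ?_
    filter_upwards [Iio_mem_nhds hx] with y hy using tpow_of_neg hy
  · rw [tpow_of_nonneg hx]
    refine (hasDerivAt_pow_div_factorial k x).hasDerivWithinAt.congr ?_ ?_
    · intro y hy
      exact tpow_of_nonneg (hx.trans hy)
    · exact tpow_of_nonneg hx

theorem hasDerivAt_tpow {k : ℕ} (hk : k ≠ 0) (x : ℝ) :
    HasDerivAt (tpow (k + 1)) (tpow k x) x := by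
  have hr := hasDerivWithinAt_tpow_right k x
  rcases lt_trichotomy x 0 with hx | hx | hx
  · rw [tpow_of_neg hx]
    refine (hasDerivAt_const x (0 : ℝ)).congr_of_eventuallyEq ?_
    filter_upwards [Iio_mem_nhds hx] with y hy using tpow_of_neg hy
  · have hl : HasDerivWithinAt (tpow (k + 1)) (tpow k x) (Set.Iic x) x := by
      have h0 : tpow k x = 0 := by rw [hx, tpow_of_nonneg le_rfl, zero_pow hk, zero_div]
      rw [h0]
      refine (hasDerivWithinAt_const x (Set.Iic x) (0 : ℝ)).congr ?_ ?_
      · intro y hy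
        rcases lt_or_eq_of_le (show y ≤ x from hy) with h | h
        · exact tpow_of_neg (by linarith)
        · rw [h, hx, tpow_of_nonneg le_rfl]; simp
      · rw [hx, tpow_of_nonneg le_rfl]; simp
    have := hl.union hr
    rwa [Set.Iic_union_Ici, hasDerivWithinAt_univ] at this
  · rw [tpow_of_nonneg hx.le]
    refine (hasDerivAt_pow_div_factorial k x).congr_of_eventuallyEq ?_
    filter_upwards [Ioi_mem_nhds hx] with y hy using tpow_of_nonneg (le_of_lt hy)

/-- The `n`-th backward difference of the truncated power of degree `k`. -/
noncomputable def bdiff : ℕ → ℕ → ℝ → ℝ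
  | 0, k, x => tpow k x
  | n + 1, k, x => bdiff n k x - bdiff n k (x - 1)

theorem bdiff_of_neg (n k : ℕ) {x : ℝ} (hx : x < 0) : bdiff n k x = 0 := by
  induction n generalizing x with
  | zero => exact tpow_of_neg hx
  | succ n ih => rw [bdiff, ih hx, ih (by linarith), sub_zero]

theorem bdiff_leibniz (n k : ℕ) (x : ℝ) :
    ((k : ℝ) + 1) * bdiff (n + 1) (k + 1) x =
      x * bdiff (n + 1) k x + ((n : ℝ) + 1) * bdiff n k (x - 1) := by
  induction n generalizing x with
  | zero =>
    have h1 := succ_mul_tpow_succ k x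
    have h2 := succ_mul_tpow_succ k (x - 1)
    simp only [bdiff, Nat.cast_zero]
    linear_combination h1 - h2
  | succ n ih =>
    have h1 := ih x
    have h2 := ih (x - 1)
    have e1 : ∀ k x, bdiff (n + 1 + 1) k x = bdiff (n + 1) k x - bdiff (n + 1) k (x - 1) :=
      fun _ _ => rfl
    have e2 : bdiff (n + 1) k (x - 1) = bdiff n k (x - 1) - bdiff n k (x - 1 - 1) := rfl
    rw [e1, e1]
    push_cast
    linear_combination h1 - h2 - ((n : ℝ) + 1) * e2

theorem bspline_recurrence (m : ℕ) (x : ℝ) :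
    ((m : ℝ) + 1) * bdiff (m + 2) (m + 1) x =
      x * bdiff (m + 1) m x + ((m : ℝ) + 2 - x) * bdiff (m + 1) m (x - 1) := by
  have h := bdiff_leibniz (m + 1) m x
  have e : bdiff (m + 1 + 1) m x = bdiff (m + 1) m x - bdiff (m + 1) m (x - 1) := rfl
  rw [e] at h
  push_cast at h
  linear_combination h

theorem bdiff_of_le (m c : ℕ) {x : ℝ} (hx : (m : ℝ) + 1 ≤ x) : bdiff (m + 1) (m - c) x = 0 := by
  induction m generalizing c x with
  | zero =>
    simp only [Nat.cast_zero, zero_add] at hx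
    simp only [Nat.zero_sub, bdiff]
    rw [tpow_of_nonneg (by linarith), tpow_of_nonneg (by linarith)]
    simp
  | succ m ih =>
    push_cast at hx
    have hz : ∀ c, bdiff (m + 1) (m - c) x = 0 := fun c => ih c (by linarith)
    have hz' : ∀ c, bdiff (m + 1) (m - c) (x - 1) = 0 := fun c => ih c (by linarith)
    cases c with
    | zero =>
      have h := bspline_recurrence m x
      have h0 := hz 0
      have h0' := hz' 0
      simp only [Nat.sub_zero] at h0 h0' ⊢
      rw [h0, h0', mul_zero, mul_zero, add_zero] at h
      exact (mul_eq_zero.1 h).resolve_left (by positivity)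
    | succ c =>
      rw [Nat.succ_sub_succ, bdiff, hz, hz', sub_zero]

theorem bspline_nonneg (m : ℕ) (x : ℝ) : 0 ≤ bdiff (m + 1) m x := by
  induction m generalizing x with
  | zero =>
    simp only [bdiff, tpow]
    split_ifs <;> norm_num
    linarith
  | succ m ih =>
    rcases lt_or_ge x 0 with hx | hx
    · rw [bdiff_of_neg _ _ hx]
    rcases le_or_gt ((m : ℝ) + 2) x with hx2 | hx2
    · exact (bdiff_of_le (m + 1) 0 (by push_cast; linarith)).ge
    have h := bspline_recurrence m x
    have h1 := mul_nonneg hx (ih x)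
    have h2 := mul_nonneg (sub_nonneg.2 hx2.le) (ih (x - 1))
    have h3 : 0 ≤ ((m : ℝ) + 1) * bdiff (m + 2) (m + 1) x := by rw [h]; exact add_nonneg h1 h2
    exact nonneg_of_mul_nonneg_right h3 (by positivity)

/-- The elementary symmetric polynomial of degree `k` in `w + 1, …, w + m`. -/
noncomputable def esym : ℕ → ℕ → ℝ → ℝ
  | _, 0, _ => 1
  | 0, _ + 1, _ => 0
  | m + 1, k + 1, w => esym m (k + 1) w + (w + m + 1) * esym m k w

theorem esym_zero_right (m : ℕ) (w : ℝ) : esym m 0 w = 1 := by cases m <;> rfl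

theorem esym_sub_one (m k : ℕ) (w : ℝ) :
    esym (m + 1) (k + 1) (w - 1) = esym m (k + 1) w + w * esym m k w := by
  induction m generalizing k with
  | zero =>
    cases k <;> simp [esym]
  | succ m ih =>
    cases k with
    | zero =>
      have h := ih 0
      have e1 : esym (m + 1 + 1) (0 + 1) (w - 1) = esym (m + 1) (0 + 1) (w - 1)
        + (w - 1 + (m + 1 : ℕ) + 1) * esym (m + 1) 0 (w - 1) := rfl
      have e2 : esym (m + 1) (0 + 1) w = esym m (0 + 1) w + (w + m + 1) * esym m 0 w := rfl
      rw [e1, e2, h]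
      simp only [esym_zero_right]
      push_cast
      ring
    | succ k =>
      have e1 : esym (m + 1 + 1) (k + 1 + 1) (w - 1) = esym (m + 1) (k + 1 + 1) (w - 1)
        + (w - 1 + (m + 1 : ℕ) + 1) * esym (m + 1) (k + 1) (w - 1) := rfl
      have e2 : ∀ k, esym (m + 1) (k + 1) w = esym m (k + 1) w + (w + m + 1) * esym m k w :=
        fun _ => rfl
      rw [e1, ih, ih, e2, e2]
      push_cast
      ring

theorem hasDerivAt_esym (m k : ℕ) (w : ℝ) :
    HasDerivAt (esym m (k + 1)) (((m : ℝ) - k) * esym m k w) w := by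
  induction m generalizing k with
  | zero =>
    have : esym 0 (k + 1) = fun _ => (0 : ℝ) := rfl
    rw [this]
    refine (hasDerivAt_const w (0 : ℝ)).congr_deriv ?_
    cases k <;> simp [esym]
  | succ m ih =>
    have e : esym (m + 1) (k + 1) = fun w => esym m (k + 1) w + (w + m + 1) * esym m k w := rfl
    rw [e]
    have hl : HasDerivAt (fun w : ℝ => w + m + 1) 1 w :=
      ((hasDerivAt_id w).add_const (m : ℝ)).add_const 1
    cases k with
    | zero =>
      have h0 : esym m 0 = fun _ => (1 : ℝ) := funext (esym_zero_right m)
      have h := (ih 0).add (hl.mul (h0 ▸ hasDerivAt_const w (1 : ℝ) : HasDerivAt (esym m 0) 0 w))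
      refine h.congr_deriv ?_
      simp only [esym_zero_right]
      push_cast
      ring
    | succ k =>
      refine ((ih (k + 1)).add (hl.mul (ih k))).congr_deriv ?_
      have e2 : esym (m + 1) (k + 1) w = esym m (k + 1) w + (w + m + 1) * esym m k w := rfl
      rw [e2]
      push_cast
      ring

theorem abs_esym_le (m k : ℕ) (w ρ : ℝ) (hρ : 0 ≤ ρ)
    (h : ∀ l : ℕ, 1 ≤ l → l ≤ m → |w + l| ≤ ρ) : |esym m k w| ≤ m.choose k * ρ ^ k := by
  induction m generalizing k with
  | zero => cases k <;> simp [esym]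
  | succ m ih =>
    have ih' := fun k => ih k fun l h1 h2 => h l h1 (h2.trans m.le_succ)
    cases k with
    | zero => simp [esym]
    | succ k =>
      have hm := h (m + 1) (by omega) le_rfl
      push_cast at hm
      rw [← add_assoc] at hm
      calc |esym (m + 1) (k + 1) w| = |esym m (k + 1) w + (w + m + 1) * esym m k w| := rfl
        _ ≤ |esym m (k + 1) w| + |w + m + 1| * |esym m k w| := by
            rw [← abs_mul]; exact abs_add_le _ _
        _ ≤ m.choose (k + 1) * ρ ^ (k + 1) + ρ * (m.choose k * ρ ^ k) := by
            gcongr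
            · exact ih' _
            · exact ih' _
        _ = _ := by
            rw [Nat.choose_succ_succ]
            push_cast
            ring

theorem sum_esym_mul_bdiff (m c k : ℕ) (hc : c ≤ m) {u : ℝ} (hu : 0 ≤ u) (hu1 : u < 1) :
    ∑ i ∈ Finset.range (m + 1), esym m k (-(u + i)) * bdiff (m + 1) (m - c) (u + i) =
      if k = c then (m.descFactorial k : ℝ) else 0 := by
  induction m generalizing c k with
  | zero =>
    obtain rfl : c = 0 := by omega
    cases k with
    | zero =>
      simp only [zero_add, Finset.sum_range_one, Nat.cast_zero, add_zero, bdiff, Nat.sub_self,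
        esym]
      rw [tpow_of_nonneg hu, tpow_of_neg (by linarith)]
      simp
    | succ k => simp [esym]
  | succ m ih =>
    have hzero : bdiff (m + 1) (m - (c - 1)) (u + ((m + 1 : ℕ) : ℝ)) = 0 :=
      bdiff_of_le m _ (by push_cast; linarith)
    cases c with
    | zero =>
      simp only [Nat.sub_zero]
      have hzero' : bdiff (m + 1) m (u + ((m + 1 : ℕ) : ℝ)) = 0 := by simpa using hzero
      have key : ∀ g : ℝ → ℝ,
          ((m : ℝ) + 1) * ∑ i ∈ Finset.range (m + 1 + 1), g (-(u + i)) *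
              bdiff (m + 1 + 1) (m + 1) (u + i) =
            ∑ i ∈ Finset.range (m + 1), ((u + i) * g (-(u + i)) +
              ((m : ℝ) + 1 - (u + i)) * g (-(u + i) - 1)) * bdiff (m + 1) m (u + i) := by
        intro g
        rw [Finset.mul_sum]
        have : ∀ i ∈ Finset.range (m + 1 + 1), ((m : ℝ) + 1) * (g (-(u + i)) *
              bdiff (m + 1 + 1) (m + 1) (u + i)) =
            (u + i) * g (-(u + i)) * bdiff (m + 1) m (u + i) +
              ((m : ℝ) + 2 - (u + i)) * g (-(u + i)) * bdiff (m + 1) m (u + i - 1) := by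
          intro i _
          have h := bspline_recurrence m (u + i)
          linear_combination g (-(u + i)) * h
        rw [Finset.sum_congr rfl this, Finset.sum_add_distrib, Finset.sum_range_succ, hzero',
          mul_zero, add_zero, Finset.sum_range_succ' (fun i : ℕ => ((m : ℝ) + 2 - (u + i)) *
            g (-(u + i)) * bdiff (m + 1) m (u + i - 1)),
          bdiff_of_neg _ _ (x := u + ((0 : ℕ) : ℝ) - 1) (by push_cast; linarith), mul_zero,
          add_zero, ← Finset.sum_add_distrib]
        refine Finset.sum_congr rfl fun i _ => ?_
        push_cast
        rw [show u + ((i : ℝ) + 1) - 1 = u + i by ring,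
          show -(u + ((i : ℝ) + 1)) = -(u + i) - 1 by ring]
        ring
      have hm : (m : ℝ) + 1 ≠ 0 := by positivity
      apply mul_left_cancel₀ hm
      rw [key]
      have ihk := ih 0 k (Nat.zero_le _)
      rw [Nat.sub_zero] at ihk
      cases k with
      | zero =>
        simp only [esym_zero_right, if_true, Nat.descFactorial_zero, Nat.cast_one, one_mul,
          mul_one] at ihk ⊢
        trans ((m : ℝ) + 1) * ∑ i ∈ Finset.range (m + 1), bdiff (m + 1) m (u + i)
        · rw [Finset.mul_sum]
          refine Finset.sum_congr rfl fun i _ => ?_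
          ring
        · rw [ihk, mul_one]
      | succ k =>
        rw [if_neg (Nat.succ_ne_zero k)] at ihk ⊢
        rw [← ihk, Finset.mul_sum]
        refine Finset.sum_congr rfl fun i _ => ?_
        rw [esym_sub_one]
        have e : esym (m + 1) (k + 1) (-(u + i)) =
          esym m (k + 1) (-(u + i)) + (-(u + i) + m + 1) * esym m k (-(u + i)) := rfl
        rw [e]
        ring
    | succ c =>
      rw [Nat.add_sub_cancel] at hzero
      rw [Nat.succ_sub_succ]
      have hs : ∀ g : ℝ → ℝ, ∑ i ∈ Finset.range (m + 1 + 1), g (-(u + i)) *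
            bdiff (m + 1 + 1) (m - c) (u + i) =
          ∑ i ∈ Finset.range (m + 1), (g (-(u + i)) - g (-(u + i) - 1)) *
            bdiff (m + 1) (m - c) (u + i) := by
        intro g
        have : ∀ i ∈ Finset.range (m + 1 + 1), g (-(u + i)) *
              bdiff (m + 1 + 1) (m - c) (u + i) =
            g (-(u + i)) * bdiff (m + 1) (m - c) (u + i) -
              g (-(u + i)) * bdiff (m + 1) (m - c) (u + i - 1) := by
          intro i _
          rw [bdiff, mul_sub]
        rw [Finset.sum_congr rfl this, Finset.sum_sub_distrib, Finset.sum_range_succ, hzero,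
          mul_zero, add_zero, Finset.sum_range_succ' (fun i : ℕ =>
            g (-(u + i)) * bdiff (m + 1) (m - c) (u + i - 1)),
          bdiff_of_neg _ _ (x := u + ((0 : ℕ) : ℝ) - 1) (by push_cast; linarith), mul_zero,
          add_zero, ← Finset.sum_sub_distrib]
        refine Finset.sum_congr rfl fun i _ => ?_
        push_cast
        rw [show u + ((i : ℝ) + 1) - 1 = u + i by ring,
          show -(u + ((i : ℝ) + 1)) = -(u + i) - 1 by ring]
        ring
      rw [hs]
      cases k with
      | zero => simp [esym_zero_right]
      | succ k =>
        have ihk := ih c k (by omega)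
        have : ∀ i ∈ Finset.range (m + 1), (esym (m + 1) (k + 1) (-(u + i)) -
            esym (m + 1) (k + 1) (-(u + i) - 1)) * bdiff (m + 1) (m - c) (u + i) =
            ((m : ℝ) + 1) * (esym m k (-(u + i)) * bdiff (m + 1) (m - c) (u + i)) := by
          intro i _
          rw [esym_sub_one]
          have e : esym (m + 1) (k + 1) (-(u + i)) =
            esym m (k + 1) (-(u + i)) + (-(u + i) + m + 1) * esym m k (-(u + i)) := rfl
          rw [e]
          ring
        rw [Finset.sum_congr rfl this, ← Finset.mul_sum, ihk]
        simp only [Nat.add_right_cancel_iff]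
        split_ifs
        · rw [Nat.succ_descFactorial_succ]; push_cast; ring
        · simp

theorem sum_abs_bdiff_le (m c : ℕ) (hc : c ≤ m) {u : ℝ} (hu : 0 ≤ u) (hu1 : u < 1) :
    ∑ i ∈ Finset.range (m + 1), |bdiff (m + 1) (m - c) (u + i)| ≤ 2 ^ c := by
  induction c generalizing m with
  | zero =>
    have h := sum_esym_mul_bdiff m 0 0 (Nat.zero_le _) hu hu1
    simp only [esym_zero_right, one_mul, if_true, Nat.descFactorial_zero, Nat.cast_one,
      Nat.sub_zero] at h
    rw [pow_zero, Nat.sub_zero, ← h]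
    exact le_of_eq (Finset.sum_congr rfl fun i _ => abs_of_nonneg (bspline_nonneg m _))
  | succ c ih =>
    obtain ⟨m, rfl⟩ : ∃ m', m = m' + 1 := ⟨m - 1, by omega⟩
    rw [Nat.succ_sub_succ]
    have ihm := ih m (by omega)
    calc ∑ i ∈ Finset.range (m + 1 + 1), |bdiff (m + 1 + 1) (m - c) (u + i)|
        ≤ ∑ i ∈ Finset.range (m + 1 + 1), (|bdiff (m + 1) (m - c) (u + i)| +
            |bdiff (m + 1) (m - c) (u + i - 1)|) := by
          refine Finset.sum_le_sum fun i _ => ?_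
          rw [bdiff]
          exact abs_sub _ _
      _ = 2 * ∑ i ∈ Finset.range (m + 1), |bdiff (m + 1) (m - c) (u + i)| := by
          rw [Finset.sum_add_distrib, Finset.sum_range_succ,
            bdiff_of_le m _ (x := u + ((m + 1 : ℕ) : ℝ)) (by push_cast; linarith), abs_zero,
            add_zero, Finset.sum_range_succ' (fun i : ℕ => |bdiff (m + 1) (m - c) (u + i - 1)|),
            bdiff_of_neg _ _ (x := u + ((0 : ℕ) : ℝ) - 1) (by push_cast; linarith), abs_zero,
            add_zero, two_mul]
          congr 1
          refine Finset.sum_congr rfl fun i _ => ?_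
          push_cast
          rw [show u + ((i : ℝ) + 1) - 1 = u + i by ring]
      _ ≤ 2 * 2 ^ c := by gcongr
      _ = 2 ^ (c + 1) := by ring

theorem bdiff_eq_sum (n k : ℕ) (x : ℝ) :
    bdiff n k x = ∑ i ∈ Finset.range (n + 1), (-1 : ℝ) ^ i * n.choose i * tpow k (x - i) := by
  induction n generalizing x with
  | zero => simp [bdiff]
  | succ n ih =>
    rw [bdiff, ih, ih, Finset.sum_range_succ' _ (n + 1)]
    have h1 : ∑ i ∈ Finset.range (n + 1), (-1 : ℝ) ^ i * n.choose i * tpow k (x - i) =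
        ∑ i ∈ Finset.range (n + 1), (-1 : ℝ) ^ (i + 1) * n.choose (i + 1) *
          tpow k (x - (i + 1 : ℕ)) + tpow k x := by
      rw [Finset.sum_range_succ', Finset.sum_range_succ]
      simp
    rw [h1]
    simp only [Nat.choose_succ_succ, Nat.succ_eq_add_one]
    simp only [pow_zero, Nat.choose_zero_right, Nat.cast_one, Nat.cast_zero, sub_zero, one_mul]
    rw [add_sub_right_comm, ← Finset.sum_sub_distrib]
    congr 1
    refine Finset.sum_congr rfl fun i _ => ?_
    push_cast
    rw [show x - 1 - (i : ℝ) = x - ((i : ℝ) + 1) by ring]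
    ring

/-- The coefficient of the truncated power with knot `(m - q) / K` in the `j`-th B-spline. -/
noncomputable def wcoef (q K j m : ℕ) : ℝ :=
  if j ≤ m then (K : ℝ) ^ q * ((-1) ^ (m - j) * (q + 1).choose (m - j)) else 0

theorem abs_wcoef_le (q K j m : ℕ) : |wcoef q K j m| ≤ (K : ℝ) ^ q * 2 ^ (q + 1) := by
  unfold wcoef
  split_ifs
  · rw [abs_mul, abs_mul, abs_neg_one_pow, one_mul, abs_pow, Nat.abs_cast, Nat.abs_cast]
    gcongr
    exact_mod_cast Nat.choose_le_two_pow _ _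
  · rw [abs_zero]; positivity

theorem sum_wcoef_mul_tpow {q K c : ℕ} (hK : 0 < K) (hc : c ≤ q) (j : Fin (K + q)) {x : ℝ}
    (hx : x < 1) :
    ∑ m : Fin (K + q), wcoef q K j m * tpow (q - c) (x - ((m : ℝ) - q) / K) =
      (K : ℝ) ^ c * bdiff (q + 1) (q - c) (K * x - ((j : ℝ) - q)) := by
  have hK' : (0 : ℝ) < K := by exact_mod_cast hK
  set g : ℕ → ℝ := fun m => wcoef q K j m * tpow (q - c) (x - ((m : ℝ) - q) / K) with hg
  have h1 : ∑ m ∈ Finset.range (K + q), g m = ∑ m ∈ Finset.range (K + q + (q + 2)), g m := by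
    refine Finset.sum_subset (Finset.range_mono (by omega)) fun m _ hm => ?_
    rw [Finset.mem_range, not_lt] at hm
    have hm' : (K : ℝ) + q ≤ m := by exact_mod_cast hm
    have : 1 ≤ ((m : ℝ) - q) / K := by rw [le_div_iff₀ hK']; linarith
    simp only [hg]
    rw [tpow_of_neg (by linarith), mul_zero]
  have h2 : ∑ m ∈ Finset.Ico (j : ℕ) (j + (q + 2)), g m =
      ∑ m ∈ Finset.range (K + q + (q + 2)), g m := by
    refine Finset.sum_subset (fun m hm => ?_) fun m _ hm => ?_
    · have := j.2
      rw [Finset.mem_Ico] at hm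
      rw [Finset.mem_range]
      omega
    · rw [Finset.mem_Ico, not_and, not_lt] at hm
      simp only [hg, wcoef]
      split_ifs with h
      · rw [Nat.choose_eq_zero_of_lt (by have := hm h; omega)]
        simp
      · simp
  rw [Fin.sum_univ_eq_sum_range g, h1, ← h2, Finset.sum_Ico_eq_sum_range, bdiff_eq_sum,
    Finset.mul_sum, Nat.add_sub_cancel_left]
  refine Finset.sum_congr rfl fun i _ => ?_
  have e : (K : ℝ) * x - ((j : ℝ) - q) - i = K * (x - (((j + i : ℕ) : ℝ) - q) / K) := by
    push_cast
    field_simp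
    ring
  have hp : (K : ℝ) ^ q = K ^ c * K ^ (q - c) := by rw [← pow_add, Nat.add_sub_cancel' hc]
  simp only [hg, wcoef]
  rw [if_pos (by omega), e, tpow_mul hK', Nat.add_sub_cancel_left, hp]
  ring

/-- Coefficients of the de Boor-Fix dual functionals. -/
noncomputable def bcoef (q k : ℕ) (w : ℝ) : ℝ := esym q k w / q.descFactorial k

theorem bcoef_zero (q : ℕ) (w : ℝ) : bcoef q 0 w = 1 := by simp [bcoef, esym_zero_right]

theorem hasDerivAt_bcoef {q k : ℕ} (hk : k < q) (w : ℝ) :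
    HasDerivAt (bcoef q (k + 1)) (bcoef q k w) w := by
  refine ((hasDerivAt_esym q k w).div_const _).congr_deriv ?_
  have h1 : ((q - k : ℕ) : ℝ) = (q : ℝ) - k := Nat.cast_sub hk.le
  have h2 : ((q - k : ℕ) : ℝ) ≠ 0 := by
    rw [Nat.cast_ne_zero]; omega
  rw [Nat.descFactorial_succ, Nat.cast_mul, bcoef, h1] at *
  rw [mul_div_mul_left _ _ h2]

theorem abs_bcoef_le {q k : ℕ} (hk : k ≤ q) {w ρ : ℝ} (hρ : 0 ≤ ρ)
    (h : ∀ l : ℕ, 1 ≤ l → l ≤ q → |w + l| ≤ ρ) : |bcoef q k w| ≤ ρ ^ k / k.factorial := by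
  have h0 : (0 : ℝ) < q.descFactorial k := by
    exact_mod_cast Nat.pos_of_ne_zero fun h => by
      rw [Nat.descFactorial_eq_zero_iff_lt] at h; omega
  have h1 : (q.descFactorial k : ℝ) = k.factorial * q.choose k := by
    exact_mod_cast Nat.descFactorial_eq_factorial_mul_choose q k
  have h2 : (0 : ℝ) < k.factorial := by positivity
  rw [bcoef, abs_div, abs_of_pos h0, div_le_div_iff₀ h0 h2, h1]
  have := mul_le_mul_of_nonneg_right (abs_esym_le q k w ρ hρ h) h2.le
  linarith

theorem sum_shift_eq {q K : ℕ} {x : ℝ} (hx : 0 ≤ x) (hx1 : x < 1) (hK : 0 < K) (φ : ℝ → ℝ)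
    (h0 : ∀ w < 0, φ w = 0) (h1 : ∀ w, (q : ℝ) + 1 ≤ w → φ w = 0) :
    ∑ j : Fin (K + q), φ (K * x - ((j : ℝ) - q)) =
      ∑ i ∈ Finset.range (q + 1), φ (K * x - ⌊K * x⌋₊ + i) := by
  have hK' : (0 : ℝ) < K := by exact_mod_cast hK
  have hn0 : 0 ≤ K * x := by positivity
  set n := ⌊K * x⌋₊ with hn
  have hn1 : (n : ℝ) ≤ K * x := Nat.floor_le hn0
  have hn2 : K * x < n + 1 := Nat.lt_floor_add_one _
  have hnK : n < K := by
    have : (n : ℝ) < K := by nlinarith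
    exact_mod_cast this
  rw [Fin.sum_univ_eq_sum_range (fun j : ℕ => φ (K * x - ((j : ℝ) - q)))]
  have h2 : ∑ j ∈ Finset.Ico n (n + (q + 1)), φ (K * x - ((j : ℝ) - q)) =
      ∑ j ∈ Finset.range (K + q), φ (K * x - ((j : ℝ) - q)) := by
    refine Finset.sum_subset (fun m hm => ?_) fun m _ hm => ?_
    · rw [Finset.mem_Ico] at hm
      rw [Finset.mem_range]
      omega
    · rw [Finset.mem_Ico, not_and_or, not_le, not_lt] at hm
      rcases hm with hm | hm
      · have : (m : ℝ) + 1 ≤ n := by exact_mod_cast hm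
        exact h1 _ (by linarith)
      · have : (n : ℝ) + (q + 1) ≤ m := by exact_mod_cast hm
        exact h0 _ (by linarith)
  rw [← h2, Finset.sum_Ico_eq_sum_range, Nat.add_sub_cancel_left, ← Finset.sum_range_reflect]
  refine Finset.sum_congr rfl fun i hi => ?_
  rw [Finset.mem_range] at hi
  congr 1
  have : ((q + 1 - 1 - i : ℕ) : ℝ) = (q : ℝ) - i := by
    rw [Nat.add_sub_cancel, Nat.cast_sub (by omega)]
  rw [Nat.cast_add, this]
  ring

theorem sum_bcoef_mul_bdiff {q K k c : ℕ} {x : ℝ} (hx : 0 ≤ x) (hx1 : x < 1) (hK : 0 < K)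
    (hk : k ≤ q) (hc : c ≤ q) :
    ∑ j : Fin (K + q), bcoef q k (((j : ℝ) - q) - K * x) *
      bdiff (q + 1) (q - c) (K * x - ((j : ℝ) - q)) = if k = c then 1 else 0 := by
  have h := sum_shift_eq (q := q) hx hx1 hK
    (fun w => bcoef q k (-w) * bdiff (q + 1) (q - c) w)
    (fun w hw => by rw [bdiff_of_neg _ _ hw, mul_zero])
    (fun w hw => by rw [bdiff_of_le _ _ hw, mul_zero])
  simp only [neg_sub] at h
  have hn0 : 0 ≤ K * x := by positivity
  have hd : (q.descFactorial k : ℝ) ≠ 0 := by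
    rw [Nat.cast_ne_zero, Ne, Nat.descFactorial_eq_zero_iff_lt]; omega
  have h2 := sum_esym_mul_bdiff q c k hc (u := K * x - ⌊K * x⌋₊)
    (by linarith [Nat.floor_le hn0]) (by linarith [Nat.lt_floor_add_one (K * x)])
  rw [h]
  simp only [bcoef, div_mul_eq_mul_div]
  rw [← Finset.sum_div, h2]
  split_ifs
  · exact div_self hd
  · exact zero_div _

theorem sum_abs_bdiff_shift_le {q K c : ℕ} {x : ℝ} (hx : 0 ≤ x) (hx1 : x < 1) (hK : 0 < K)
    (hc : c ≤ q) :
    ∑ j : Fin (K + q), |bdiff (q + 1) (q - c) (K * x - ((j : ℝ) - q))| ≤ 2 ^ c := by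
  have h := sum_shift_eq (q := q) hx hx1 hK (fun w => |bdiff (q + 1) (q - c) w|)
    (fun w hw => by rw [bdiff_of_neg _ _ hw, abs_zero])
    (fun w hw => by rw [bdiff_of_le _ _ hw, abs_zero])
  have hn0 : 0 ≤ K * x := by positivity
  rw [h]
  exact sum_abs_bdiff_le q c hc (by linarith [Nat.floor_le hn0])
    (by linarith [Nat.lt_floor_add_one (K * x)])

/-- The multi-indices of total order less than `n`. -/
noncomputable def multiIndices (d n : ℕ) : Finset (Fin d → ℕ) :=
  (Fintype.piFinset fun _ => Finset.range n).filter fun κ => ∑ i, κ i < n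

theorem mem_multiIndices {d n : ℕ} {κ : Fin d → ℕ} : κ ∈ multiIndices d n ↔ ∑ i, κ i < n := by
  simp only [multiIndices, Finset.mem_filter, Fintype.mem_piFinset, Finset.mem_range,
    and_iff_right_iff_imp]
  exact fun h i => (Finset.single_le_sum (fun j _ => Nat.zero_le (κ j))
    (Finset.mem_univ i)).trans_lt h

theorem sub_single_add_single {d : ℕ} {κ : Fin d → ℕ} {i : Fin d} (hκ : κ i ≠ 0) :
    κ - Pi.single i 1 + Pi.single i 1 = κ := by
  refine tsub_add_cancel_of_le fun j => ?_
  by_cases hj : j = i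
  · subst hj; simp; omega
  · simp [hj]

theorem sum_multiIndices_succ {d n : ℕ} (i : Fin d) (ψ : (Fin d → ℕ) → ℝ) :
    ∑ κ ∈ multiIndices d (n + 1), (if κ i = 0 then 0 else ψ κ) =
      ∑ κ ∈ multiIndices d n, ψ (κ + Pi.single i 1) := by
  have e : ∀ κ : Fin d → ℕ, (if κ i = 0 then 0 else ψ κ) = if κ i ≠ 0 then ψ κ else 0 := by
    intro κ
    by_cases h : κ i = 0 <;> simp [h]
  simp only [e]
  rw [← Finset.sum_filter]
  refine Finset.sum_nbij' (fun κ => κ - Pi.single i 1) (fun κ => κ + Pi.single i 1)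
    ?_ ?_ ?_ ?_ ?_
  · intro κ hκ
    rw [Finset.mem_filter, mem_multiIndices] at hκ
    rw [mem_multiIndices]
    have := sum_add_single (κ - Pi.single i 1) i 1
    rw [sub_single_add_single hκ.2] at this
    omega
  · intro κ hκ
    rw [mem_multiIndices] at hκ
    rw [Finset.mem_filter, mem_multiIndices, sum_add_single]
    exact ⟨by omega, by simp⟩
  · intro κ hκ
    exact sub_single_add_single (Finset.mem_filter.1 hκ).2
  · intro κ _
    exact add_tsub_cancel_right _ _
  · intro κ hκ
    rw [sub_single_add_single (Finset.mem_filter.1 hκ).2]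

/-- Tensor products of the coefficient polynomials `bcoef`. -/
noncomputable def tensorCoef {d : ℕ} (q K : ℕ) (a : Fin d → ℝ) (κ : Fin d → ℕ) (y : Fin d → ℝ) : ℝ :=
  ∏ i, bcoef q (κ i) (a i - K * y i)

theorem hasDerivAt_bcoef_pred {q k : ℕ} (hk : k ≤ q) (w : ℝ) :
    HasDerivAt (bcoef q k) (if k = 0 then 0 else bcoef q (k - 1) w) w := by
  cases k with
  | zero =>
    rw [if_pos rfl, show bcoef q 0 = fun _ => (1 : ℝ) from funext (bcoef_zero q)]
    exact hasDerivAt_const _ _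
  | succ k =>
    rw [if_neg (Nat.succ_ne_zero k), Nat.add_sub_cancel]
    exact hasDerivAt_bcoef hk w

theorem hasDerivAt_tensorCoef {d q K : ℕ} (a : Fin d → ℝ) {κ : Fin d → ℕ} (hκ : ∀ i, κ i ≤ q)
    (x v : Fin d → ℝ) (t : ℝ) :
    HasDerivAt (fun s : ℝ => tensorCoef q K a κ (x + s • v))
      (∑ i, -(K * v i) *
        (if κ i = 0 then 0 else tensorCoef q K a (κ - Pi.single i 1) (x + t • v))) t := by
  have h1 : ∀ i, HasDerivAt (fun s : ℝ => a i - K * (x + s • v) i) (-(K * v i)) t := by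
    intro i
    have : HasDerivAt (fun s : ℝ => a i - K * (x i + s * v i)) (-(K * (1 * v i))) t :=
      ((((hasDerivAt_id t).mul_const (v i)).const_add (x i)).const_mul (K : ℝ)).const_sub (a i)
    simpa using this
  have h2 := HasDerivAt.fun_finsetProd (u := Finset.univ) (x := t) fun i _ =>
    (hasDerivAt_bcoef_pred (hκ i) (a i - K * (x + t • v) i)).comp t (h1 i)
  refine h2.congr_deriv (Finset.sum_congr rfl fun i _ => ?_)
  split_ifs with h
  · simp
  · have e : tensorCoef q K a (κ - Pi.single i 1) (x + t • v) =
        bcoef q (κ i - 1) (a i - K * (x + t • v) i) *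
          ∏ j ∈ Finset.univ.erase i, bcoef q (κ j) (a j - K * (x + t • v) j) := by
      rw [tensorCoef, ← Finset.mul_prod_erase _ _ (Finset.mem_univ i)]
      congr 1
      · simp
      · refine Finset.prod_congr rfl fun j hj => ?_
        have : j ≠ i := Finset.ne_of_mem_erase hj
        simp [this]
    rw [e, smul_eq_mul]
    simp only [Function.comp_apply]
    ring

theorem sum_abs_tensorCoef_le {d q K : ℕ} {a y : Fin d → ℝ}
    (hy : ∀ i, 0 ≤ K * y i - a i ∧ K * y i - a i ≤ q + 1) {s : Finset (Fin d → ℕ)}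
    (hs : s ⊆ multiIndices d (q + 1)) :
    ∑ κ ∈ s, |tensorCoef q K a κ y| ≤ Real.exp (d * q) := by
  calc ∑ κ ∈ s, |tensorCoef q K a κ y|
      ≤ ∑ κ ∈ s, ∏ i, ((q : ℝ) ^ κ i / (κ i).factorial) := by
        refine Finset.sum_le_sum fun κ hκ => ?_
        have hκ' := mem_multiIndices.1 (hs hκ)
        rw [tensorCoef, Finset.abs_prod]
        refine Finset.prod_le_prod (fun _ _ => abs_nonneg _) fun i _ => ?_
        have hi : κ i ≤ q := by
          have := Finset.single_le_sum (fun j _ => Nat.zero_le (κ j)) (Finset.mem_univ i)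
          omega
        refine abs_bcoef_le hi (Nat.cast_nonneg q) fun l hl1 hl2 => ?_
        have h1 : (1 : ℝ) ≤ l := by exact_mod_cast hl1
        have h2 : (l : ℝ) ≤ q := by exact_mod_cast hl2
        rw [abs_le]
        constructor <;> linarith [(hy i).1, (hy i).2]
    _ ≤ ∑ κ ∈ Fintype.piFinset fun _ : Fin d => Finset.range (q + 1),
          ∏ i, ((q : ℝ) ^ κ i / (κ i).factorial) :=
        Finset.sum_le_sum_of_subset_of_nonneg (hs.trans (Finset.filter_subset _ _))
          fun _ _ _ => Finset.prod_nonneg fun _ _ => by positivity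
    _ = ∏ _i : Fin d, ∑ k ∈ Finset.range (q + 1), (q : ℝ) ^ k / k.factorial := by
        rw [Finset.prod_univ_sum]
    _ ≤ ∏ _i : Fin d, Real.exp q :=
        Finset.prod_le_prod (fun _ _ => Finset.sum_nonneg fun _ _ => by positivity)
          fun _ _ => Real.sum_le_exp_of_nonneg (Nat.cast_nonneg q) _
    _ = Real.exp (d * q) := by
        rw [Finset.prod_const, Finset.card_univ, Fintype.card_fin, ← Real.exp_nat_mul]

/-- The dual functional of a B-spline, as a function of the base point. -/
noncomputable def dualFun {d : ℕ} (q K : ℕ) (G : (Fin d → ℕ) → (Fin d → ℝ) → ℝ) (a : Fin d → ℝ)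
    (y : Fin d → ℝ) : ℝ :=
  ∑ κ ∈ multiIndices d (q + 1), ((K : ℝ) ^ ∑ i, κ i)⁻¹ * G κ y * tensorCoef q K a κ y

theorem abs_dualFun_le {d q K : ℕ} (hK : 0 < K) {G : (Fin d → ℕ) → (Fin d → ℝ) → ℝ} {H : ℝ}
    {a y : Fin d → ℝ} (hG : ∀ κ, ∑ i, κ i ≤ q → |G κ y| ≤ H)
    (hy : ∀ i, 0 ≤ K * y i - a i ∧ K * y i - a i ≤ q + 1) :
    |dualFun q K G a y| ≤ H * Real.exp (d * q) := by
  have hH : 0 ≤ H := (abs_nonneg _).trans (hG 0 (by simp))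
  have hK' : (1 : ℝ) ≤ K := by exact_mod_cast hK
  refine (Finset.abs_sum_le_sum_abs _ _).trans ?_
  refine le_trans ?_ (mul_le_mul_of_nonneg_left (sum_abs_tensorCoef_le hy subset_rfl) hH)
  rw [Finset.mul_sum]
  refine Finset.sum_le_sum fun κ hκ => ?_
  rw [abs_mul, abs_mul, abs_of_nonneg (by positivity)]
  refine mul_le_mul_of_nonneg_right ?_ (abs_nonneg _)
  have h1 : ((K : ℝ) ^ ∑ i, κ i)⁻¹ ≤ 1 := inv_le_one_of_one_le₀ (one_le_pow₀ hK')
  have h2 := hG κ (by have := mem_multiIndices.1 hκ; omega)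
  calc _ ≤ 1 * |G κ y| := mul_le_mul_of_nonneg_right h1 (abs_nonneg _)
    _ ≤ H := by rwa [one_mul]

theorem abs_dualFun_sub_le {d q K : ℕ} (hK : 0 < K)
    {G : (Fin d → ℕ) → (Fin d → ℝ) → ℝ} (hG : IsJet q G)
    {a x z : Fin d → ℝ} {ω : ℝ} (hω0 : 0 ≤ ω) (hω : ∀ κ, ∑ i, κ i = q → ∀ t ∈ Set.Icc (0 : ℝ) 1,
      |G κ (x + t • (z - x)) - G κ x| ≤ ω)
    (hx : ∀ i, 0 ≤ K * x i - a i ∧ K * x i - a i ≤ q + 1)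
    (hz : ∀ i, 0 ≤ K * z i - a i ∧ K * z i - a i ≤ q + 1) :
    |dualFun q K G a z - dualFun q K G a x| ≤
      ((K : ℝ) ^ q)⁻¹ * ω * Real.exp (d * q) * (1 + d * (q + 1)) := by
  have hK' : (0 : ℝ) < K := by exact_mod_cast hK
  set v := z - x with hv
  set E := Real.exp (d * q) with hE
  set b := tensorCoef q K a with hb
  set A : (Fin d → ℕ) → ℝ → ℝ := fun κ t => if ∑ i, κ i < q then G κ (x + t • v) else G κ x with hA
  set φ : ℝ → ℝ := fun t => ∑ κ ∈ multiIndices d (q + 1),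
    ((K : ℝ) ^ ∑ i, κ i)⁻¹ * A κ t * b κ (x + t • v) with hφ
  have hseg : ∀ t ∈ Set.Icc (0 : ℝ) 1, ∀ i, 0 ≤ K * (x + t • v) i - a i ∧
      K * (x + t • v) i - a i ≤ q + 1 := by
    intro t ht i
    have e : K * (x + t • v) i - a i = (1 - t) * (K * x i - a i) + t * (K * z i - a i) := by
      simp [hv]; ring
    rw [e]
    obtain ⟨h1, h2⟩ := hx i
    obtain ⟨h3, h4⟩ := hz i
    obtain ⟨h5, h6⟩ := ht
    constructor
    · exact add_nonneg (mul_nonneg (by linarith) h1) (mul_nonneg h5 h3)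
    · nlinarith
  have hvb : ∀ i, |v i| ≤ (q + 1) / K := by
    intro i
    rw [le_div_iff₀ hK', ← abs_of_pos hK', ← abs_mul, abs_le]
    have e : v i * K = (K * z i - a i) - (K * x i - a i) := by simp [hv]; ring
    rw [e]
    constructor <;> linarith [(hx i).1, (hx i).2, (hz i).1, (hz i).2]
  have hA' : ∀ κ t, HasDerivAt (A κ)
      (if ∑ i, κ i < q then ∑ i, v i * G (κ + Pi.single i 1) (x + t • v) else 0) t := by
    intro κ t
    by_cases h : ∑ i, κ i < q
    · simp only [hA, h, if_true]
      have h1 : HasDerivAt (fun s : ℝ => x + s • v) v t := by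
        simpa using ((hasDerivAt_id t).smul_const v).const_add x
      refine ((hG κ h (x + t • v)).comp_hasDerivAt t h1).congr_deriv ?_
      simp [mul_comm]
    · simp only [hA, h, if_false]
      exact hasDerivAt_const _ _
  have hφ' : ∀ t, HasDerivAt φ (∑ i, v i * ∑ κ ∈ multiIndices d q, ((K : ℝ) ^ ∑ i, κ i)⁻¹ *
      (G (κ + Pi.single i 1) (x + t • v) - A (κ + Pi.single i 1) t) * b κ (x + t • v)) t := by
    intro t
    have h1 := HasDerivAt.fun_sum (u := multiIndices d (q + 1)) (x := t) fun κ hκ =>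
      ((hA' κ t).const_mul (((K : ℝ) ^ ∑ i, κ i)⁻¹)).mul
        (hasDerivAt_tensorCoef (q := q) (K := K) a (κ := κ) (fun i => by
          have := mem_multiIndices.1 hκ
          have := Finset.single_le_sum (fun j _ => Nat.zero_le (κ j)) (Finset.mem_univ i)
          omega) x v t)
    refine h1.congr_deriv ?_
    rw [Finset.sum_add_distrib]
    have e1 : ∑ κ ∈ multiIndices d (q + 1), ((K : ℝ) ^ ∑ i, κ i)⁻¹ *
        (if ∑ i, κ i < q then ∑ i, v i * G (κ + Pi.single i 1) (x + t • v) else 0) *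
          tensorCoef q K a κ (x + t • v) =
        ∑ i, v i * ∑ κ ∈ multiIndices d q, ((K : ℝ) ^ ∑ i, κ i)⁻¹ *
          G (κ + Pi.single i 1) (x + t • v) * b κ (x + t • v) := by
      have hsub : multiIndices d q ⊆ multiIndices d (q + 1) := fun κ hκ => by
        rw [mem_multiIndices] at *; omega
      rw [← Finset.sum_subset hsub]
      · simp only [Finset.mul_sum]
        rw [Finset.sum_comm]
        refine Finset.sum_congr rfl fun κ hκ => ?_
        rw [if_pos (mem_multiIndices.1 hκ), Finset.mul_sum, Finset.sum_mul]
        exact Finset.sum_congr rfl fun i _ => by rw [hb]; ring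
      · intro κ _ hκ
        rw [mem_multiIndices] at hκ
        rw [if_neg hκ]; ring
    have e2 : ∑ κ ∈ multiIndices d (q + 1), ((K : ℝ) ^ ∑ i, κ i)⁻¹ * A κ t *
        (∑ i, -(K * v i) *
          (if κ i = 0 then 0 else tensorCoef q K a (κ - Pi.single i 1) (x + t • v))) =
        -∑ i, v i * ∑ κ ∈ multiIndices d q, ((K : ℝ) ^ ∑ i, κ i)⁻¹ *
          A (κ + Pi.single i 1) t * b κ (x + t • v) := by
      simp only [Finset.mul_sum]
      rw [Finset.sum_comm, ← Finset.sum_neg_distrib]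
      refine Finset.sum_congr rfl fun i _ => ?_
      have e3 := sum_multiIndices_succ (n := q) i fun κ => ((K : ℝ) ^ ∑ i, κ i)⁻¹ * A κ t *
        (-(K * v i) * tensorCoef q K a (κ - Pi.single i 1) (x + t • v))
      rw [← Finset.sum_neg_distrib]
      calc _ = _ := Finset.sum_congr rfl fun κ _ => by split_ifs <;> simp
        _ = _ := e3
        _ = _ := Finset.sum_congr rfl fun κ _ => by
            rw [sum_add_single, add_tsub_cancel_right, pow_succ]
            field_simp
            rw [hb]
    rw [e1, e2, ← sub_eq_add_neg, ← Finset.sum_sub_distrib]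
    refine Finset.sum_congr rfl fun i _ => ?_
    rw [← mul_sub, ← Finset.sum_sub_distrib]
    congr 1
    exact Finset.sum_congr rfl fun κ _ => by ring
  have hbound : ∀ t ∈ Set.Icc (0 : ℝ) 1, |∑ i, v i * ∑ κ ∈ multiIndices d q,
      ((K : ℝ) ^ ∑ i, κ i)⁻¹ * (G (κ + Pi.single i 1) (x + t • v) - A (κ + Pi.single i 1) t) *
        b κ (x + t • v)| ≤ ((K : ℝ) ^ q)⁻¹ * ω * E * (d * (q + 1)) := by
    intro t ht
    have h1 : ∀ i, |∑ κ ∈ multiIndices d q, ((K : ℝ) ^ ∑ i, κ i)⁻¹ *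
        (G (κ + Pi.single i 1) (x + t • v) - A (κ + Pi.single i 1) t) * b κ (x + t • v)| ≤
        K * ((K : ℝ) ^ q)⁻¹ * ω * E := by
      intro i
      refine (Finset.abs_sum_le_sum_abs _ _).trans ?_
      refine le_trans ?_ (mul_le_mul_of_nonneg_left (sum_abs_tensorCoef_le (hseg t ht)
        (s := multiIndices d q) fun κ hκ => by rw [mem_multiIndices] at *; omega) (by positivity))
      rw [Finset.mul_sum]
      refine Finset.sum_le_sum fun κ hκ => ?_
      rw [abs_mul]
      refine mul_le_mul_of_nonneg_right ?_ (abs_nonneg _)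
      rw [mem_multiIndices] at hκ
      simp only [hA, sum_add_single]
      split_ifs with h
      · rw [sub_self, mul_zero, abs_zero]; positivity
      · have hκq : ∑ i, κ i + 1 = q := by omega
        rw [abs_mul, abs_of_nonneg (by positivity)]
        refine mul_le_mul (le_of_eq ?_) (hω _ (by rw [sum_add_single]; exact hκq) t ht)
          (abs_nonneg _) (by positivity)
        rw [← hκq, pow_succ]
        field_simp
    refine (Finset.abs_sum_le_sum_abs _ _).trans ?_
    calc _ ≤ ∑ _i : Fin d, (q + 1) / K * (K * ((K : ℝ) ^ q)⁻¹ * ω * E) :=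
          Finset.sum_le_sum fun i _ => by
            rw [abs_mul]
            exact mul_le_mul (hvb i) (h1 i) (abs_nonneg _) (by positivity)
      _ = _ := by
          rw [Finset.sum_const, Finset.card_univ, Fintype.card_fin, nsmul_eq_mul]
          field_simp
  have hmvt : |φ 1 - φ 0| ≤ ((K : ℝ) ^ q)⁻¹ * ω * E * (d * (q + 1)) :=
    norm_image_sub_le_of_norm_deriv_le_segment_01'
      (fun t _ => (hφ' t).hasDerivWithinAt) fun t ht => hbound t (Set.Ico_subset_Icc_self ht)
  have h0 : φ 0 = dualFun q K G a x := by
    simp [hφ, hA, dualFun, hb]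
  have h1 : |dualFun q K G a z - φ 1| ≤ ((K : ℝ) ^ q)⁻¹ * ω * E := by
    have hx1 : x + (1 : ℝ) • v = z := by simp [hv]
    simp only [hφ, dualFun, hx1, hA]
    rw [← Finset.sum_sub_distrib]
    refine (Finset.abs_sum_le_sum_abs _ _).trans ?_
    refine le_trans ?_ (mul_le_mul_of_nonneg_left (sum_abs_tensorCoef_le hz
      (s := multiIndices d (q + 1)) subset_rfl) (by positivity))
    rw [Finset.mul_sum]
    refine Finset.sum_le_sum fun κ hκ => ?_
    rw [hb, ← sub_mul, ← mul_sub, abs_mul]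
    refine mul_le_mul_of_nonneg_right ?_ (abs_nonneg _)
    rw [mem_multiIndices] at hκ
    split_ifs with h
    · rw [sub_self, mul_zero, abs_zero]; positivity
    · have hκq : ∑ i, κ i = q := by omega
      rw [abs_mul, abs_of_nonneg (by positivity), hκq]
      have := hω κ hκq 1 (by simp)
      rw [hx1] at this
      exact mul_le_mul_of_nonneg_left this (by positivity)
  rw [h0] at hmvt
  calc _ = |(dualFun q K G a z - φ 1) + (φ 1 - dualFun q K G a x)| := by congr 1; ring
    _ ≤ _ := (abs_add_le _ _).trans (add_le_add h1 hmvt)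
    _ = _ := by ring

/-- The partial derivatives of the spline with coefficients `c` in the basis of tensor products of
truncated powers of degree `q`. -/
noncomputable def splineJet {d : ℕ} (q K : ℕ) (c : (Fin d → Fin (K + q)) → ℝ) (γ : Fin d → ℕ)
    (x : Fin d → ℝ) : ℝ :=
  ∑ m, c m * ∏ i, tpow (q - γ i) (x i - ((m i : ℝ) - q) / K)

theorem le_sum_fin {d : ℕ} (γ : Fin d → ℕ) (i : Fin d) : γ i ≤ ∑ j, γ j :=
  Finset.single_le_sum (fun j _ => Nat.zero_le (γ j)) (Finset.mem_univ i)

theorem prod_tpow_add_single {d q : ℕ} (γ : Fin d → ℕ) (y : Fin d → ℝ) (i : Fin d) :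
    ∏ j, tpow (q - (γ + Pi.single i 1 : Fin d → ℕ) j) (y j) =
      tpow (q - γ i - 1) (y i) * ∏ j ∈ Finset.univ.erase i, tpow (q - γ j) (y j) := by
  rw [← Finset.mul_prod_erase _ _ (Finset.mem_univ i)]
  congr 1
  · simp [Nat.sub_sub]
  · refine Finset.prod_congr rfl fun j hj => ?_
    have : j ≠ i := Finset.ne_of_mem_erase hj
    simp [this]

theorem isJet_splineJet {d q K : ℕ} (c : (Fin d → Fin (K + q)) → ℝ) :
    IsJet (q - 1) (splineJet q K c) := by
  intro γ hγ x
  have h1 : ∀ (m : Fin d → Fin (K + q)) i, HasFDerivAt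
      (fun y : Fin d → ℝ => tpow (q - γ i) (y i - ((m i : ℝ) - q) / K))
      (tpow (q - γ i - 1) (x i - ((m i : ℝ) - q) / K) •
        (ContinuousLinearMap.proj i : (Fin d → ℝ) →L[ℝ] ℝ)) x := by
    intro m i
    have hi := le_sum_fin γ i
    have h2 := hasDerivAt_tpow (k := q - γ i - 1) (by omega) (x i - ((m i : ℝ) - q) / K)
    rw [show q - γ i - 1 + 1 = q - γ i by omega] at h2
    have h3 : HasFDerivAt (fun y : Fin d → ℝ => y i - ((m i : ℝ) - q) / K)
        (ContinuousLinearMap.proj i : (Fin d → ℝ) →L[ℝ] ℝ) x :=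
      (ContinuousLinearMap.proj (R := ℝ) (φ := fun _ : Fin d => ℝ) i).hasFDerivAt.sub_const _
    exact h2.comp_hasFDerivAt x h3
  have h4 := HasFDerivAt.fun_sum (u := Finset.univ) (x := x) fun m _ =>
    (HasFDerivAt.finsetProd (u := Finset.univ) (x := x) fun i _ => h1 m i).const_mul (c m)
  refine h4.congr_fderiv ?_
  simp only [Finset.smul_sum, splineJet, Finset.sum_smul]
  rw [Finset.sum_comm]
  refine Finset.sum_congr rfl fun i _ => Finset.sum_congr rfl fun m _ => ?_
  rw [prod_tpow_add_single γ (fun j => x j - ((m j : ℝ) - q) / K), smul_smul, smul_smul]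
  congr 1
  ring

theorem continuous_splineJet {d q K : ℕ} (c : (Fin d → Fin (K + q)) → ℝ) {γ : Fin d → ℕ}
    (hγ : ∑ i, γ i < q) : Continuous (splineJet q K c γ) := by
  refine continuous_finsetSum _ fun m _ => continuous_const.mul
    (continuous_finsetProd _ fun i _ => ?_)
  have hi := le_sum_fin γ i
  exact (continuous_tpow (by omega)).comp (by fun_prop)

theorem hasDerivWithinAt_splineJet {d q K : ℕ} (c : (Fin d → Fin (K + q)) → ℝ) {γ : Fin d → ℕ}
    (hγ : ∑ i, γ i < q) (x : Fin d → ℝ) (i : Fin d) (t : ℝ) :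
    HasDerivWithinAt (fun s => splineJet q K c γ (Function.update x i s))
      (splineJet q K c (γ + Pi.single i 1) (Function.update x i t)) (Set.Ici t) t := by
  have hi := le_sum_fin γ i
  have e : ∀ s, splineJet q K c γ (Function.update x i s) = ∑ m, c m *
      (tpow (q - γ i - 1 + 1) (s - ((m i : ℝ) - q) / K) *
        ∏ j ∈ Finset.univ.erase i, tpow (q - γ j) (x j - ((m j : ℝ) - q) / K)) := by
    intro s
    refine Finset.sum_congr rfl fun m _ => ?_
    rw [← Finset.mul_prod_erase _ _ (Finset.mem_univ i), Function.update_self,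
      show q - γ i - 1 + 1 = q - γ i by omega]
    congr 2
    refine Finset.prod_congr rfl fun j hj => ?_
    rw [Function.update_of_ne (Finset.ne_of_mem_erase hj)]
  simp only [e]
  have h1 : ∀ m : Fin d → Fin (K + q), HasDerivWithinAt
      (fun s : ℝ => tpow (q - γ i - 1 + 1) (s - ((m i : ℝ) - q) / K))
      (tpow (q - γ i - 1) (t - ((m i : ℝ) - q) / K)) (Set.Ici t) t := by
    intro m
    have h2 := hasDerivWithinAt_tpow_right (q - γ i - 1) (t - ((m i : ℝ) - q) / K)
    have h3 : HasDerivWithinAt (fun s : ℝ => s - ((m i : ℝ) - q) / K) 1 (Set.Ici t) t :=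
      ((hasDerivAt_id t).sub_const _).hasDerivWithinAt
    have h4 := h2.comp t h3 fun s (hs : t ≤ s) => show _ ≤ _ by linarith
    rwa [mul_one] at h4
  refine (HasDerivWithinAt.fun_sum fun m _ =>
    ((h1 m).mul_const _).const_mul (c m)).congr_deriv ?_
  refine Finset.sum_congr rfl fun m _ => ?_
  rw [prod_tpow_add_single γ (fun j => Function.update x i t j - ((m j : ℝ) - q) / K),
    Function.update_self]
  congr 2
  refine Finset.prod_congr rfl fun j hj => ?_
  rw [Function.update_of_ne (Finset.ne_of_mem_erase hj)]

theorem IsJet.hasDerivWithinAt_update {d n : ℕ} {G : (Fin d → ℕ) → (Fin d → ℝ) → ℝ}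
    (hG : IsJet n G) {γ : Fin d → ℕ} (hγ : ∑ i, γ i < n) (x : Fin d → ℝ) (i : Fin d) (t : ℝ)
    (s : Set ℝ) :
    HasDerivWithinAt (fun s => G γ (Function.update x i s))
      (G (γ + Pi.single i 1) (Function.update x i t)) s t := by
  have h := (hG γ hγ (Function.update x i t)).comp_hasDerivAt t (hasDerivAt_update x i t)
  refine (h.congr_deriv ?_).hasDerivWithinAt
  simp [Pi.single_apply]

theorem le_of_forall_mem_Ioo {u v : ℝ → ℝ} (hu : Continuous u) (hv : Continuous v)
    (h : ∀ r ∈ Set.Ioo (0 : ℝ) 1, u r ≤ v r) : u 1 ≤ v 1 := by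
  refine le_of_tendsto_of_tendsto (b := nhdsWithin 1 (Set.Iio 1))
    (hu.continuousAt.mono_left nhdsWithin_le_nhds) (hv.continuousAt.mono_left nhdsWithin_le_nhds) ?_
  filter_upwards [Ioo_mem_nhdsLT (zero_lt_one' ℝ)] with r hr using h r hr

theorem smul_mem_halfOpen {d : ℕ} {x : Fin d → ℝ} (hx : x ∈ cube d) {r : ℝ}
    (hr : r ∈ Set.Ioo (0 : ℝ) 1) (i : Fin d) : 0 ≤ (r • x) i ∧ (r • x) i < 1 := by
  have h0 : 0 ≤ x i := hx.1 i
  have h1 : x i ≤ 1 := hx.2 i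
  simp only [Pi.smul_apply, smul_eq_mul]
  constructor
  · exact mul_nonneg hr.1.le h0
  · nlinarith [hr.1, hr.2]

theorem abs_le_on_cube {d : ℕ} {Φ : (Fin d → ℝ) → ℝ} (hΦ : Continuous Φ) {B : ℝ}
    (h : ∀ x : Fin d → ℝ, (∀ i, 0 ≤ x i ∧ x i < 1) → |Φ x| ≤ B) {x : Fin d → ℝ}
    (hx : x ∈ cube d) : |Φ x| ≤ B := by
  have := le_of_forall_mem_Ioo (u := fun r : ℝ => |Φ (r • x)|) (v := fun _ => B)
    (by fun_prop) continuous_const fun r hr => h _ (smul_mem_halfOpen hx hr)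
  simpa using this

theorem abs_sub_le_of_partial_le {d : ℕ} {Φ : (Fin d → ℝ) → ℝ} (hΦ : Continuous Φ)
    {D : Fin d → (Fin d → ℝ) → ℝ} {B : ℝ}
    (hD : ∀ x i t, HasDerivWithinAt (fun s => Φ (Function.update x i s))
      (D i (Function.update x i t)) (Set.Ici t) t)
    (hB : ∀ i (x : Fin d → ℝ), (∀ j, 0 ≤ x j ∧ x j < 1) → |D i x| ≤ B) {x y : Fin d → ℝ}
    (hx : x ∈ cube d) (hy : y ∈ cube d) : |Φ y - Φ x| ≤ B * ∑ i, |y i - x i| := by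
  have h1 : ∀ (z : Fin d → ℝ) i a b, (∀ j, 0 ≤ z j ∧ z j < 1) → 0 ≤ a → a ≤ b → b < 1 →
      |Φ (Function.update z i b) - Φ (Function.update z i a)| ≤ B * (b - a) := by
    intro z i a b hz ha hab hb
    refine norm_image_sub_le_of_norm_deriv_right_le_segment
      (f := fun s => Φ (Function.update z i s)) (a := a) (b := b) ?_ (fun t _ => hD z i t) ?_ b
      ⟨hab, le_rfl⟩
    · exact (hΦ.comp (continuous_const.update i continuous_id)).continuousOn
    · intro t ht
      refine hB i _ fun j => ?_
      by_cases hj : j = i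
      · subst hj
        rw [Function.update_self]
        exact ⟨ha.trans ht.1, ht.2.trans hb⟩
      · rw [Function.update_of_ne hj]
        exact hz j
  have h2 : ∀ (z : Fin d → ℝ) i a b, (∀ j, 0 ≤ z j ∧ z j < 1) → 0 ≤ a → a < 1 → 0 ≤ b → b < 1 →
      |Φ (Function.update z i b) - Φ (Function.update z i a)| ≤ B * |b - a| := by
    intro z i a b hz ha ha1 hb hb1
    rcases le_total a b with h | h
    · rw [abs_of_nonneg (sub_nonneg.2 h)]
      exact h1 z i a b hz ha h hb1
    · rw [abs_sub_comm, abs_sub_comm b a, abs_of_nonneg (sub_nonneg.2 h)]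
      exact h1 z i b a hz hb h ha1
  have h3 : ∀ x y : Fin d → ℝ, (∀ j, 0 ≤ x j ∧ x j < 1) → (∀ j, 0 ≤ y j ∧ y j < 1) →
      |Φ y - Φ x| ≤ B * ∑ i, |y i - x i| := by
    intro x y hx hy
    have h4 : ∀ s : Finset (Fin d), |Φ (s.piecewise y x) - Φ x| ≤ B * ∑ i ∈ s, |y i - x i| := by
      intro s
      induction s using Finset.induction_on with
      | empty => simp
      | insert i s hi ih =>
        set z := s.piecewise y x with hz
        have hz' : ∀ j, 0 ≤ z j ∧ z j < 1 := fun j => by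
          by_cases hj : j ∈ s
          · rw [hz, Finset.piecewise_eq_of_mem _ _ _ hj]; exact hy j
          · rw [hz, Finset.piecewise_eq_of_notMem _ _ _ hj]; exact hx j
        have h5 := h2 z i (x i) (y i) hz' (hx i).1 (hx i).2 (hy i).1 (hy i).2
        have e : Function.update z i (x i) = z := by
          rw [Function.update_eq_iff]
          exact ⟨by rw [hz, Finset.piecewise_eq_of_notMem _ _ _ hi], fun _ _ => rfl⟩
        rw [e] at h5
        rw [Finset.piecewise_insert, Finset.sum_insert hi, mul_add]
        calc _ = |(Φ (Function.update z i (y i)) - Φ z) + (Φ z - Φ x)| := by congr 1; ring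
          _ ≤ _ := (abs_add_le _ _).trans (add_le_add h5 ih)
    simpa using h4 Finset.univ
  have h6 := le_of_forall_mem_Ioo (u := fun r : ℝ => |Φ (r • y) - Φ (r • x)|)
    (v := fun r => B * ∑ i, |(r • y) i - (r • x) i|) (by fun_prop)
    (by simp only [Pi.smul_apply]; fun_prop)
    fun r hr => h3 _ _ (smul_mem_halfOpen hx hr) (smul_mem_halfOpen hy hr)
  simpa using h6

/-- Truncated power coefficients of the spline with B-spline coefficients `l`. -/
noncomputable def toTruncated {d : ℕ} (q K : ℕ) (l : (Fin d → Fin (K + q)) → ℝ)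
    (m : Fin d → Fin (K + q)) : ℝ :=
  ∑ j, l j * ∏ i, wcoef q K (j i) (m i)

theorem splineJet_toTruncated {d q K : ℕ} (hK : 0 < K) (l : (Fin d → Fin (K + q)) → ℝ)
    {γ : Fin d → ℕ} (hγ : ∑ i, γ i ≤ q) {x : Fin d → ℝ} (hx : ∀ i, x i < 1) :
    splineJet q K (toTruncated q K l) γ x =
      ∑ j, l j * ∏ i, ((K : ℝ) ^ γ i * bdiff (q + 1) (q - γ i) (K * x i - ((j i : ℝ) - q))) := by
  simp only [splineJet, toTruncated, Finset.sum_mul]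
  rw [Finset.sum_comm]
  refine Finset.sum_congr rfl fun j _ => ?_
  simp only [mul_assoc]
  rw [← Finset.mul_sum]
  congr 1
  simp only [← Finset.prod_mul_distrib]
  have h := Finset.prod_univ_sum (fun _ : Fin d => (Finset.univ : Finset (Fin (K + q))))
    fun i m => wcoef q K (j i) m * tpow (q - γ i) (x i - ((m : ℝ) - q) / K)
  rw [Fintype.piFinset_univ] at h
  rw [← h]
  exact Finset.prod_congr rfl fun i _ =>
    sum_wcoef_mul_tpow hK ((le_sum_fin γ i).trans hγ) (j i) (hx i)

theorem sum_dualFun_mul {d q K : ℕ} (hK : 0 < K) (G : (Fin d → ℕ) → (Fin d → ℝ) → ℝ)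
    {γ : Fin d → ℕ} (hγ : ∑ i, γ i ≤ q) {x : Fin d → ℝ} (hx : ∀ i, 0 ≤ x i ∧ x i < 1) :
    ∑ j : Fin d → Fin (K + q), dualFun q K G (fun i => (j i : ℝ) - q) x *
      ∏ i, ((K : ℝ) ^ γ i * bdiff (q + 1) (q - γ i) (K * x i - ((j i : ℝ) - q))) = G γ x := by
  have hK' : (0 : ℝ) < K := by exact_mod_cast hK
  simp only [dualFun, Finset.sum_mul]
  rw [Finset.sum_comm]
  have h : ∀ κ ∈ multiIndices d (q + 1), ∑ j : Fin d → Fin (K + q),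
      ((K : ℝ) ^ ∑ i, κ i)⁻¹ * G κ x * tensorCoef q K (fun i => (j i : ℝ) - q) κ x *
        ∏ i, ((K : ℝ) ^ γ i * bdiff (q + 1) (q - γ i) (K * x i - ((j i : ℝ) - q))) =
      if κ = γ then G γ x else 0 := by
    intro κ hκ
    rw [mem_multiIndices] at hκ
    simp only [tensorCoef, mul_assoc, ← Finset.prod_mul_distrib]
    rw [← Finset.mul_sum, ← Finset.mul_sum]
    have h1 := Finset.prod_univ_sum (fun _ : Fin d => (Finset.univ : Finset (Fin (K + q))))
      fun i m => bcoef q (κ i) (((m : ℝ) - q) - K * x i) *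
        ((K : ℝ) ^ γ i * bdiff (q + 1) (q - γ i) (K * x i - ((m : ℝ) - q)))
    rw [Fintype.piFinset_univ] at h1
    rw [← h1]
    have h2 : ∀ i, ∑ m : Fin (K + q), bcoef q (κ i) (((m : ℝ) - q) - K * x i) *
        ((K : ℝ) ^ γ i * bdiff (q + 1) (q - γ i) (K * x i - ((m : ℝ) - q))) =
        if κ i = γ i then (K : ℝ) ^ γ i else 0 := by
      intro i
      have h3 := sum_bcoef_mul_bdiff (hx i).1 (hx i).2 hK (k := κ i) (c := γ i) (q := q)
        (by have := le_sum_fin κ i; omega) ((le_sum_fin γ i).trans hγ)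
      calc _ = (K : ℝ) ^ γ i * ∑ m : Fin (K + q), bcoef q (κ i) (((m : ℝ) - q) - K * x i) *
            bdiff (q + 1) (q - γ i) (K * x i - ((m : ℝ) - q)) := by
            rw [Finset.mul_sum]
            exact Finset.sum_congr rfl fun _ _ => by ring
        _ = _ := by rw [h3]; split_ifs <;> simp
    rw [Finset.prod_congr rfl fun i _ => h2 i]
    split_ifs with hκγ
    · subst hκγ
      simp only [if_true]
      rw [Finset.prod_pow_eq_pow_sum]
      field_simp
    · obtain ⟨i, hi⟩ := Function.ne_iff.1 hκγ
      rw [Finset.prod_eq_zero (Finset.mem_univ i) (if_neg hi)]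
      simp
  rw [Finset.sum_congr rfl h, Finset.sum_ite_eq', if_pos (mem_multiIndices.2 (by omega))]

theorem sum_prod_abs_bdiff_le {d q K : ℕ} (hK : 0 < K) {γ : Fin d → ℕ} (hγ : ∑ i, γ i ≤ q)
    {x : Fin d → ℝ} (hx : ∀ i, 0 ≤ x i ∧ x i < 1) :
    ∑ j : Fin d → Fin (K + q),
      |∏ i, ((K : ℝ) ^ γ i * bdiff (q + 1) (q - γ i) (K * x i - ((j i : ℝ) - q)))| ≤
      (2 * K : ℝ) ^ ∑ i, γ i := by
  simp only [Finset.abs_prod]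
  have h1 := Finset.prod_univ_sum (fun _ : Fin d => (Finset.univ : Finset (Fin (K + q))))
    fun i m => |(K : ℝ) ^ γ i * bdiff (q + 1) (q - γ i) (K * x i - ((m : ℝ) - q))|
  rw [Fintype.piFinset_univ] at h1
  rw [← h1, ← Finset.prod_pow_eq_pow_sum]
  refine Finset.prod_le_prod (fun _ _ => Finset.sum_nonneg fun _ _ => abs_nonneg _) fun i _ => ?_
  simp only [abs_mul, abs_pow, Nat.abs_cast]
  rw [← Finset.mul_sum, mul_comm (2 : ℝ), mul_pow]
  exact mul_le_mul_of_nonneg_left (sum_abs_bdiff_shift_le (hx i).1 (hx i).2 hK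
    ((le_sum_fin γ i).trans hγ)) (by positivity)

theorem abs_sub_splineJet_le {d q K : ℕ} (hK : 0 < K) {G : (Fin d → ℕ) → (Fin d → ℝ) → ℝ}
    {l : (Fin d → Fin (K + q)) → ℝ} {R : ℝ} {x : Fin d → ℝ} (hx : ∀ i, 0 ≤ x i ∧ x i < 1)
    (hR0 : 0 ≤ R) (hR : ∀ j : Fin d → Fin (K + q),
      (∀ i, 0 ≤ K * x i - ((j i : ℝ) - q) ∧ K * x i - ((j i : ℝ) - q) ≤ q + 1) →
        |l j - dualFun q K G (fun i => (j i : ℝ) - q) x| ≤ R)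
    {γ : Fin d → ℕ} (hγ : ∑ i, γ i ≤ q) :
    |G γ x - splineJet q K (toTruncated q K l) γ x| ≤ (2 * K : ℝ) ^ (∑ i, γ i) * R := by
  rw [splineJet_toTruncated hK l hγ fun i => (hx i).2, ← sum_dualFun_mul hK G hγ hx,
    ← Finset.sum_sub_distrib]
  refine (Finset.abs_sum_le_sum_abs _ _).trans ?_
  refine le_trans ?_ (mul_le_mul_of_nonneg_right (sum_prod_abs_bdiff_le hK hγ hx) hR0)
  rw [Finset.sum_mul]
  refine Finset.sum_le_sum fun j _ => ?_
  rw [← sub_mul, abs_mul, mul_comm]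
  by_cases hj : ∀ i, 0 ≤ K * x i - ((j i : ℝ) - q) ∧ K * x i - ((j i : ℝ) - q) ≤ q + 1
  · rw [abs_sub_comm]
    exact mul_le_mul_of_nonneg_left (hR j hj) (abs_nonneg _)
  · rw [not_forall] at hj
    obtain ⟨i, hi⟩ := hj
    have h0 : bdiff (q + 1) (q - γ i) (K * x i - ((j i : ℝ) - q)) = 0 := by
      rw [not_and_or, not_le, not_le] at hi
      rcases hi with hi | hi
      · exact bdiff_of_neg _ _ hi
      · exact bdiff_of_le _ _ hi.le
    rw [Finset.prod_eq_zero (Finset.mem_univ i) (by rw [h0, mul_zero])]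
    simp

theorem abs_toTruncated_le {d q K : ℕ} {l : (Fin d → Fin (K + q)) → ℝ} {B : ℝ} (hB0 : 0 ≤ B)
    (hB : ∀ j, |l j| ≤ B) (m : Fin d → Fin (K + q)) :
    |toTruncated q K l m| ≤ B * ((K + q : ℝ) * ((K : ℝ) ^ q * 2 ^ (q + 1))) ^ d := by
  refine (Finset.abs_sum_le_sum_abs _ _).trans ?_
  have h : ∀ j ∈ (Finset.univ : Finset (Fin d → Fin (K + q))),
      |l j * ∏ i, wcoef q K (j i) (m i)| ≤ B * ((K : ℝ) ^ q * 2 ^ (q + 1)) ^ d := by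
    intro j _
    rw [abs_mul, Finset.abs_prod]
    refine mul_le_mul (hB j) ?_ (Finset.prod_nonneg fun _ _ => abs_nonneg _) hB0
    calc _ ≤ ∏ _i : Fin d, ((K : ℝ) ^ q * 2 ^ (q + 1)) :=
          Finset.prod_le_prod (fun _ _ => abs_nonneg _) fun i _ => abs_wcoef_le q K _ _
      _ = _ := by rw [Finset.prod_const, Finset.card_univ, Fintype.card_fin]
  refine (Finset.sum_le_card_nsmul _ _ _ h).trans (le_of_eq ?_)
  rw [Finset.card_univ, Fintype.card_fun, Fintype.card_fin, Fintype.card_fin, nsmul_eq_mul,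
    mul_pow ((K : ℝ) + q)]
  push_cast
  ring

theorem eucDist_le_sum {d : ℕ} (x y : Fin d → ℝ) : eucDist x y ≤ ∑ i, |x i - y i| := by
  refine Real.sqrt_le_iff.2 ⟨Finset.sum_nonneg fun _ _ => abs_nonneg _, ?_⟩
  have := Finset.sum_sq_le_sq_sum_of_nonneg (s := Finset.univ) (f := fun i => |x i - y i|)
    fun _ _ => abs_nonneg _
  simpa using this

theorem sum_le_mul_eucDist {d : ℕ} (x y : Fin d → ℝ) : ∑ i, |x i - y i| ≤ d * eucDist x y := by
  have h : ∀ i ∈ (Finset.univ : Finset (Fin d)), |x i - y i| ≤ eucDist x y := fun i _ =>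
    Real.abs_le_sqrt (Finset.single_le_sum (f := fun i => (x i - y i) ^ 2)
      (fun j _ => sq_nonneg _) (Finset.mem_univ i))
  simpa using Finset.sum_le_card_nsmul _ _ _ h

/-- The error of spline approximation, up to the factor `(2 K) ^ ℓ` for derivatives of order
`ℓ`. -/
noncomputable def splineErr (d q K : ℕ) (H δ : ℝ) : ℝ :=
  ((K : ℝ) ^ q)⁻¹ * (H * (d * ((q + 1) / K)) ^ δ) * Real.exp (d * q) * (1 + d * (q + 1))

theorem exists_spline_approx {d q K : ℕ} (hd : 0 < d) (hq : 0 < q) (hK : 0 < K) {H δ : ℝ}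
    (hH : 0 ≤ H) (hδ : 0 ≤ δ) {g : (Fin d → ℝ) → ℝ} (hg : ContDiff ℝ (q : ℕ∞) g)
    (hb : ∀ γ : Fin d → ℕ, ∑ j, γ j ≤ q → ∀ x ∈ cube d, |mderiv γ g x| ≤ H)
    (hh : ∀ γ : Fin d → ℕ, ∑ j, γ j = q → ∀ x ∈ cube d, ∀ y ∈ cube d, x ≠ y →
      |mderiv γ g x - mderiv γ g y| ≤ H * min 1 (eucDist x y) ^ δ) :
    ∃ c : (Fin d → Fin (K + q)) → ℝ,
      (∀ m, |c m| ≤ H * Real.exp (d * q) * ((K + q : ℝ) * ((K : ℝ) ^ q * 2 ^ (q + 1))) ^ d) ∧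
      ∀ ℓ ≤ q, HolderNormLeOn (cube d) ℓ (fun x => g x - splineJet q K c 0 x)
        (2 * d * (2 * K) ^ ℓ * splineErr d q K H δ) := by
  have hK' : (0 : ℝ) < K := by exact_mod_cast hK
  have hK1 : (1 : ℝ) ≤ K := by exact_mod_cast hK
  have hd1 : (1 : ℝ) ≤ d := by exact_mod_cast hd
  set G : (Fin d → ℕ) → (Fin d → ℝ) → ℝ := fun γ => mderiv γ g with hGdef
  have hG : IsJet q G := isJet_mderiv hg
  set a : (Fin d → Fin (K + q)) → Fin d → ℝ := fun j i => (j i : ℝ) - q with ha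
  set τ : (Fin d → Fin (K + q)) → Fin d → ℝ := fun j i => max (a j i) 0 / K with hτ
  have hτa : ∀ j i, 0 ≤ K * τ j i - a j i ∧ K * τ j i - a j i ≤ q + 1 := by
    intro j i
    have e : K * τ j i = max (a j i) 0 := by simp only [hτ]; field_simp
    rw [e]
    have h0 : -(q : ℝ) ≤ a j i := by simp [ha]
    refine ⟨by linarith [le_max_left (a j i) 0], ?_⟩
    rcases le_total (a j i) 0 with h | h
    · rw [max_eq_right h]; linarith
    · rw [max_eq_left h]; linarith
  have hτc : ∀ j, τ j ∈ cube d := by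
    intro j
    refine ⟨fun i => div_nonneg (le_max_right _ _) hK'.le, fun i => ?_⟩
    change max (a j i) 0 / K ≤ 1
    rw [div_le_one hK']
    refine max_le ?_ hK'.le
    have : ((j i : ℕ) : ℝ) ≤ K + q := by exact_mod_cast (j i).2.le
    simp only [ha]
    linarith
  set l : (Fin d → Fin (K + q)) → ℝ := fun j => dualFun q K G (a j) (τ j) with hl
  set R := splineErr d q K H δ with hR
  have hR0 : 0 ≤ R := by rw [hR, splineErr]; positivity
  have hloc : ∀ x : Fin d → ℝ, (∀ i, 0 ≤ x i ∧ x i < 1) → ∀ j : Fin d → Fin (K + q),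
      (∀ i, 0 ≤ K * x i - a j i ∧ K * x i - a j i ≤ q + 1) →
        |l j - dualFun q K G (a j) x| ≤ R := by
    intro x hx j hj
    refine abs_dualFun_sub_le (ω := H * (d * ((q + 1) / K)) ^ δ) hK hG (by positivity) ?_ hj (hτa j)
    intro κ hκ t ht
    have hxc : x ∈ cube d := ⟨fun i => (hx i).1, fun i => (hx i).2.le⟩
    have hyc : x + t • (τ j - x) ∈ cube d :=
      (convex_Icc (0 : Fin d → ℝ) 1).add_smul_sub_mem hxc (hτc j) ht
    by_cases hne : x + t • (τ j - x) = x
    · rw [hne, sub_self, abs_zero]; positivity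
    · refine (hh κ hκ _ hyc x hxc hne).trans (mul_le_mul_of_nonneg_left ?_ hH)
      refine Real.rpow_le_rpow (le_min zero_le_one (Real.sqrt_nonneg _)) ?_ hδ
      refine (min_le_right _ _).trans ((eucDist_le_sum _ _).trans ?_)
      have h1 : ∀ i ∈ (Finset.univ : Finset (Fin d)),
          |(x + t • (τ j - x)) i - x i| ≤ (q + 1) / K := by
        intro i _
        have e : (x + t • (τ j - x)) i - x i = t * (τ j i - x i) := by simp
        have h2 : |τ j i - x i| ≤ (q + 1) / K := by
          rw [le_div_iff₀ hK', ← abs_of_pos hK', ← abs_mul, abs_le]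
          have e : (τ j i - x i) * K = (K * τ j i - a j i) - (K * x i - a j i) := by ring
          rw [e]
          constructor <;> linarith [(hj i).1, (hj i).2, (hτa j i).1, (hτa j i).2]
        rw [e, abs_mul, abs_of_nonneg ht.1]
        calc t * |τ j i - x i| ≤ 1 * |τ j i - x i| :=
              mul_le_mul_of_nonneg_right ht.2 (abs_nonneg _)
          _ ≤ _ := by rwa [one_mul]
      simpa using Finset.sum_le_card_nsmul _ _ _ h1
  set c := toTruncated q K l with hc
  set F := splineJet q K c with hF
  have hpt : ∀ x : Fin d → ℝ, (∀ i, 0 ≤ x i ∧ x i < 1) → ∀ γ : Fin d → ℕ, ∑ i, γ i ≤ q →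
      |G γ x - F γ x| ≤ (2 * K : ℝ) ^ (∑ i, γ i) * R := fun x hx γ hγ =>
    abs_sub_splineJet_le hK hx hR0 (hloc x hx) hγ
  have hcont : ∀ γ : Fin d → ℕ, ∑ i, γ i < q → Continuous fun x => G γ x - F γ x := fun γ hγ =>
    (continuous_iff_continuousAt.2 fun x => (hG γ hγ x).continuousAt).sub
      (continuous_splineJet c hγ)
  have hclosed : ∀ γ : Fin d → ℕ, ∑ i, γ i < q → ∀ x ∈ cube d,
      |G γ x - F γ x| ≤ (2 * K : ℝ) ^ (∑ i, γ i) * R := fun γ hγ x hx =>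
    abs_le_on_cube (hcont γ hγ) (fun x hx => hpt x hx γ hγ.le) hx
  have hlip : ∀ γ : Fin d → ℕ, ∑ i, γ i < q → ∀ x ∈ cube d, ∀ y ∈ cube d,
      |(G γ x - F γ x) - (G γ y - F γ y)| ≤
        (2 * K : ℝ) ^ (∑ i, γ i + 1) * R * ∑ i, |x i - y i| := by
    intro γ hγ x hx y hy
    refine abs_sub_le_of_partial_le (Φ := fun x => G γ x - F γ x) (hcont γ hγ)
      (D := fun i x => G (γ + Pi.single i 1) x - F (γ + Pi.single i 1) x) ?_ ?_ hy hx
    · exact fun z i t => (hG.hasDerivWithinAt_update hγ z i t _).sub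
        (hasDerivWithinAt_splineJet c hγ z i t)
    · intro i z hz
      have := hpt z hz (γ + Pi.single i 1) (by rw [sum_add_single]; omega)
      rwa [sum_add_single] at this
  have h2K : (1 : ℝ) ≤ 2 * K := by linarith
  refine ⟨c, abs_toTruncated_le (by positivity) fun j => ?_, ?_⟩
  · exact abs_dualFun_le hK (fun κ hκ => hb κ hκ _ (hτc j)) (hτa j)
  intro ℓ hℓ
  have hG0 : G 0 = g := by
    have : ∀ L : List (Fin d), L.foldr (fun i h => (pderiv1 i)^[(0 : Fin d → ℕ) i] h) g = g := by
      intro L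
      induction L with
      | nil => rfl
      | cons b L ih => rw [List.foldr_cons, ih]; rfl
    exact this _
  cases ℓ with
  | zero =>
    intro x hx
    have h := hclosed 0 (by simpa using hq) x hx
    rw [hG0] at h
    refine h.trans ?_
    simp only [Pi.zero_apply, Finset.sum_const_zero, pow_zero, one_mul, mul_one]
    nlinarith
  | succ m =>
    have hjet : IsJet (q - 1) fun γ x => G γ x - F γ x :=
      hG.sub (isJet_splineJet c) (Nat.sub_le q 1)
    have hm : ∀ γ : Fin d → ℕ, ∑ i, γ i ≤ m →
        mderiv γ (fun x => g x - F 0 x) = fun x => G γ x - F γ x := by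
      intro γ hγ
      rw [← hjet.mderiv_eq (γ := γ) (by omega), hG0]
    refine ⟨fun γ hγ x hx => ?_, fun γ hγ x hx y hy _ => ?_⟩
    · rw [hm γ hγ]
      refine (hclosed γ (by omega) x hx).trans (mul_le_mul_of_nonneg_right ?_ hR0)
      calc (2 * K : ℝ) ^ (∑ i, γ i) ≤ (2 * K) ^ (m + 1) := pow_le_pow_right₀ h2K (by omega)
        _ ≤ _ := le_mul_of_one_le_left (by positivity) (by linarith)
    · rw [hm γ hγ.le]
      have hγq : ∑ i, γ i < q := by omega
      rcases le_total (eucDist x y) 1 with h | h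
      · rw [min_eq_right h]
        refine (hlip γ hγq x hx y hy).trans ?_
        rw [hγ]
        calc _ ≤ (2 * K : ℝ) ^ (m + 1) * R * (d * eucDist x y) :=
              mul_le_mul_of_nonneg_left (sum_le_mul_eucDist x y) (by positivity)
          _ ≤ 2 * ((2 * K : ℝ) ^ (m + 1) * R * (d * eucDist x y)) :=
              le_mul_of_one_le_left (mul_nonneg (by positivity)
                (mul_nonneg (by positivity) (Real.sqrt_nonneg _))) (by norm_num)
          _ = _ := by ring
      · rw [min_eq_left h, mul_one]
        have h1 := hclosed γ hγq x hx
        have h2 := hclosed γ hγq y hy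
        rw [hγ] at h1 h2
        calc _ ≤ (2 * K : ℝ) ^ m * R + (2 * K : ℝ) ^ m * R :=
              (abs_sub _ _).trans (add_le_add h1 h2)
          _ = 2 * 1 * (2 * K) ^ m * R := by ring
          _ ≤ 2 * d * (2 * K) ^ (m + 1) * R := by
              refine mul_le_mul_of_nonneg_right (mul_le_mul (by linarith)
                (pow_le_pow_right₀ h2K (Nat.le_succ m)) (by positivity) (by positivity)) hR0

theorem HolderNormLeOn.mono {d : ℕ} {Ω : Set (Fin d → ℝ)} {ℓ : ℕ} {g : (Fin d → ℝ) → ℝ}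
    {E E' : ℝ} (h : HolderNormLeOn Ω ℓ g E) (hE : E ≤ E') : HolderNormLeOn Ω ℓ g E' := by
  cases ℓ with
  | zero => exact fun x hx => (h x hx).trans hE
  | succ m =>
    refine ⟨fun γ hγ x hx => (h.1 γ hγ x hx).trans hE, fun γ hγ x hx y hy hne =>
      (h.2 γ hγ x hx y hy hne).trans (mul_le_mul_of_nonneg_right hE ?_)⟩
    exact le_min zero_le_one (Real.sqrt_nonneg _)

theorem mul_le_pow_of_two_le {a : ℝ} (ha : 2 ≤ a) {d : ℕ} (hd : 0 < d) : d * a ≤ a ^ d := by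
  induction d, hd using Nat.le_induction with
  | base => simp
  | succ d hd ih =>
    have h1 : (1 : ℝ) ≤ d := by exact_mod_cast hd
    rw [pow_succ]
    push_cast
    calc ((d : ℝ) + 1) * a ≤ d * a * a := mul_le_mul_of_nonneg_right (by nlinarith) (by linarith)
      _ ≤ a ^ d * a := mul_le_mul_of_nonneg_right ih (by linarith)

theorem splineErr_le {d q K ℓ : ℕ} {H δ β : ℝ} (hd : 0 < d) (hq : 2 ≤ q) (hK : 0 < K)
    (hH : 0 ≤ H) (hδ : 0 ≤ δ) (hδ1 : δ ≤ 1) (hβ : β = q + δ) :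
    2 * d * (2 * K) ^ ℓ * splineErr d q K H δ ≤
      (9 : ℝ) ^ (d * (q - 1)) * ((2 * q + 1 : ℕ) : ℝ) ^ (2 * d + ℓ) *
        (Real.sqrt 2 * Real.exp 1 * (d : ℝ)) ^ β * H / (K : ℝ) ^ (β - (ℓ : ℝ)) := by
  have hK' : (0 : ℝ) < K := by exact_mod_cast hK
  have hd1 : (1 : ℝ) ≤ d := by exact_mod_cast hd
  have hq2 : (2 : ℝ) ≤ q := by exact_mod_cast hq
  have hKβ : (K : ℝ) ^ (β - (ℓ : ℝ)) = (K : ℝ) ^ q * (K : ℝ) ^ δ / (K : ℝ) ^ ℓ := by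
    rw [Real.rpow_sub hK', hβ, Real.rpow_add hK', Real.rpow_natCast, Real.rpow_natCast]
  have hdq : (1 : ℝ) ≤ d * (q + 1) := by nlinarith
  have h1 : ((d : ℝ) * ((q + 1) / K)) ^ δ ≤ d * (q + 1) / (K : ℝ) ^ δ := by
    rw [← mul_div_assoc, Real.div_rpow (by positivity) hK'.le]
    gcongr
    calc _ ≤ ((d : ℝ) * (q + 1)) ^ (1 : ℝ) := Real.rpow_le_rpow_of_exponent_le hdq hδ1
      _ = _ := Real.rpow_one _
  have h2 : Real.exp (d * q) ≤ 9 ^ (d * (q - 1)) := by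
    calc Real.exp (d * q) = Real.exp 1 ^ (d * q) := by
          rw [← Real.exp_nat_mul]; push_cast; ring_nf
      _ ≤ 3 ^ (d * q) := pow_le_pow_left₀ (Real.exp_pos 1).le Real.exp_one_lt_three.le _
      _ ≤ 3 ^ (2 * (d * (q - 1))) := by
          refine pow_le_pow_right₀ (by norm_num) ?_
          rw [mul_left_comm]
          exact Nat.mul_le_mul_left d (by omega)
      _ = 9 ^ (d * (q - 1)) := by rw [pow_mul]; norm_num
  have h3 : (2 : ℝ) ^ ℓ ≤ ((2 * q + 1 : ℕ) : ℝ) ^ ℓ := by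
    refine pow_le_pow_left₀ (by norm_num) ?_ _
    push_cast
    linarith
  have h4 : (8 : ℝ) * d ^ 2 ≤ (Real.sqrt 2 * Real.exp 1 * (d : ℝ)) ^ β := by
    have he : (2 : ℝ) ≤ Real.exp 1 := by linarith [Real.add_one_le_exp 1]
    have hs : (1 : ℝ) ≤ Real.sqrt 2 := Real.one_le_sqrt.2 (by norm_num)
    have hb : (1 : ℝ) ≤ Real.sqrt 2 * Real.exp 1 * (d : ℝ) := by nlinarith [mul_le_mul hs he (by norm_num) (by positivity)]
    calc (8 : ℝ) * d ^ 2 = 2 * 2 ^ 2 * d ^ 2 := by norm_num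
      _ ≤ Real.sqrt 2 ^ 2 * Real.exp 1 ^ 2 * d ^ 2 := by
          rw [Real.sq_sqrt (by norm_num)]; gcongr
      _ = (Real.sqrt 2 * Real.exp 1 * (d : ℝ)) ^ (2 : ℝ) := by
          rw [← mul_pow, ← mul_pow, ← Real.rpow_natCast]; norm_num
      _ ≤ _ := Real.rpow_le_rpow_of_exponent_le hb (by linarith)
  have h5 : (d : ℝ) * (2 * q + 1) ^ 2 ≤ ((2 * q + 1 : ℕ) : ℝ) ^ (2 * d) := by
    rw [pow_mul]
    push_cast
    exact mul_le_pow_of_two_le (by nlinarith) hd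
  have h6 : 2 * (d : ℝ) * (d * (q + 1)) * (1 + d * (q + 1)) ≤
      8 * d ^ 2 * (d * (2 * q + 1) ^ 2) := by
    have h7 : (q + 1 : ℝ) * (1 + d * (q + 1)) ≤ (2 * q + 1) * (4 * (d * (2 * q + 1))) :=
      mul_le_mul (by linarith) (by nlinarith) (by positivity) (by positivity)
    have h8 := mul_le_mul_of_nonneg_left h7 (by positivity : (0 : ℝ) ≤ 2 * d ^ 2)
    calc _ = 2 * (d : ℝ) ^ 2 * ((q + 1 : ℝ) * (1 + d * (q + 1))) := by ring
      _ ≤ _ := h8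
      _ = _ := by ring
  have hKδ : 0 < (K : ℝ) ^ δ := Real.rpow_pos_of_pos hK' _
  calc 2 * d * (2 * K) ^ ℓ * splineErr d q K H δ
      ≤ 2 * d * (2 * K) ^ ℓ * (((K : ℝ) ^ q)⁻¹ * (H * (d * (q + 1) / (K : ℝ) ^ δ)) *
          9 ^ (d * (q - 1)) * (1 + d * (q + 1))) := by
        unfold splineErr
        gcongr
    _ = 9 ^ (d * (q - 1)) * 2 ^ ℓ * (2 * d * (d * (q + 1)) * (1 + d * (q + 1))) * H /
          ((K : ℝ) ^ q * (K : ℝ) ^ δ / (K : ℝ) ^ ℓ) := by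
        rw [mul_pow]
        field_simp
    _ ≤ 9 ^ (d * (q - 1)) * ((2 * q + 1 : ℕ) : ℝ) ^ ℓ *
          ((Real.sqrt 2 * Real.exp 1 * (d : ℝ)) ^ β * ((2 * q + 1 : ℕ) : ℝ) ^ (2 * d)) * H /
          ((K : ℝ) ^ q * (K : ℝ) ^ δ / (K : ℝ) ^ ℓ) := by
        have h7 := h6.trans (mul_le_mul h4 h5 (by positivity) (by positivity))
        gcongr
    _ = _ := by rw [hKβ, pow_add]; ring

/-- A matrix over finite types as a matrix over the natural numbers. -/
noncomputable def natMatrix {ι κ : Type} {n m : ℕ} (e : ι ≃ Fin n) (e' : κ ≃ Fin m)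
    (A : ι → κ → ℝ) (j k : ℕ) : ℝ :=
  if h : j < n ∧ k < m then A (e.symm ⟨j, h.1⟩) (e'.symm ⟨k, h.2⟩) else 0

theorem natMatrix_apply {ι κ : Type} {n m : ℕ} (e : ι ≃ Fin n) (e' : κ ≃ Fin m)
    (A : ι → κ → ℝ) (a : ι) (b : κ) : natMatrix e e' A (e a) (e' b) = A a b := by
  simp [natMatrix]

theorem natMatrix_mem {ι κ : Type} {n m : ℕ} (e : ι ≃ Fin n) (e' : κ ≃ Fin m)
    {A : ι → κ → ℝ} (hA : ∀ a b, |A a b| ≤ 1) (j k : ℕ) :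
    natMatrix e e' A j k ∈ Set.Icc (-1 : ℝ) 1 := by
  rw [Set.mem_Icc, ← abs_le, natMatrix]
  split_ifs
  · exact hA _ _
  · simp

theorem card_natMatrix_le {ι κ : Type} [Fintype ι] [Fintype κ] {n m : ℕ} (e : ι ≃ Fin n)
    (e' : κ ≃ Fin m) (A : ι → κ → ℝ) :
    ((Finset.range n ×ˢ Finset.range m).filter fun p => natMatrix e e' A p.1 p.2 ≠ 0).card ≤
      (Finset.univ.filter fun p : ι × κ => A p.1 p.2 ≠ 0).card := by
  refine le_trans (Finset.card_le_card (t := (Finset.univ.filter fun p : ι × κ =>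
    A p.1 p.2 ≠ 0).image fun p => ((e p.1 : ℕ), (e' p.2 : ℕ))) ?_) Finset.card_image_le
  rintro ⟨j, k⟩ h
  rw [Finset.mem_filter, Finset.mem_product, Finset.mem_range, Finset.mem_range] at h
  obtain ⟨⟨hj, hk⟩, h⟩ := h
  rw [Finset.mem_image]
  refine ⟨(e.symm ⟨j, hj⟩, e'.symm ⟨k, hk⟩), ?_, by simp⟩
  rw [Finset.mem_filter]
  refine ⟨Finset.mem_univ _, ?_⟩
  rwa [← natMatrix_apply e e' A, Equiv.apply_symm_apply, Equiv.apply_symm_apply]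

theorem sum_natMatrix_mul {ι κ : Type} [Fintype κ] {n m : ℕ} (e : ι ≃ Fin n)
    (e' : κ ≃ Fin m) (A : ι → κ → ℝ) (a : ι) (f : ℕ → ℝ) :
    ∑ k ∈ Finset.range m, natMatrix e e' A (e a) k * f k = ∑ b, A a b * f (e' b) := by
  rw [Finset.sum_range, ← Equiv.sum_comp e']
  exact Finset.sum_congr rfl fun b _ => by rw [natMatrix_apply]

/-- The functions `h` are the outputs of a ReQU network with `L` hidden layers, width at most `w`,
weights in `[-1, 1]`, and at most `s` nonzero weights. -/
def Computes {ι : Type} {n d : ℕ} (L w s : ℕ) (e : ι ≃ Fin n) (h : ι → (Fin d → ℝ) → ℝ) : Prop :=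
  ∃ N : ReQUNet, N.L = L ∧ N.arch 0 = d ∧ N.arch (N.L + 1) = n ∧ N.width ≤ w ∧
    N.weightsIn (Set.Icc (-1) 1) ∧ N.numNonzero ≤ s ∧ ∀ x k, N.evalVec d x (e k) = h k x

theorem computes_linear {ι : Type} [Fintype ι] {n d : ℕ} (e : ι ≃ Fin n) (A : ι → Fin d → ℝ)
    (hA : ∀ a b, |A a b| ≤ 1) :
    Computes 0 (max d n) (Finset.univ.filter fun p : ι × Fin d => A p.1 p.2 ≠ 0).card e
      fun k x => ∑ i, A k i * x i := by
  refine ⟨⟨0, fun i => if i = 0 then d else n, fun _ => natMatrix e (Equiv.refl _) A, fun _ _ => 0⟩,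
    rfl, rfl, rfl, ?_, ⟨fun _ _ _ _ _ _ => natMatrix_mem _ _ hA _ _, fun i h1 h2 => ?_⟩, ?_, ?_⟩
  · refine Finset.sup_le fun i _ => ?_
    dsimp only
    split_ifs
    · exact le_max_left _ _
    · exact le_max_right _ _
  · simp at h2; omega
  · simp only [ReQUNet.numNonzero]
    simpa using card_natMatrix_le e (Equiv.refl (Fin d)) A
  · intro x k
    simp only [ReQUNet.evalVec, ReQUNet.eval, ReQUNet.hidden, if_true]
    rw [sum_natMatrix_mul]
    simp

theorem hidden_congr {N N' : ReQUNet} {x : ℕ → ℝ} {i : ℕ} (ha : ∀ k ≤ i, N'.arch k = N.arch k)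
    (hW : ∀ k ≤ i, N'.W k = N.W k) (hv : ∀ k ≤ i, N'.v k = N.v k) :
    N'.hidden x i = N.hidden x i := by
  induction i with
  | zero =>
    funext j
    simp only [ReQUNet.hidden, ha 0 le_rfl, hW 0 le_rfl]
  | succ i ih =>
    funext j
    simp only [ReQUNet.hidden, ha (i + 1) le_rfl, hW (i + 1) le_rfl, hv (i + 1) le_rfl]
    rw [ih (fun k hk => ha k (by omega)) (fun k hk => hW k (by omega)) fun k hk => hv k (by omega)]

theorem add_le_add_four {a b c s t u v : ℕ} (h1 : a + b ≤ s) (h2 : c ≤ t) (h3 : u ≤ v) :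
    a + c + (b + u) ≤ s + t + v := by omega

theorem Computes.append {ι κ : Type} [Fintype ι] [Fintype κ] {n m d L w s : ℕ} {e : ι ≃ Fin n}
    {h : ι → (Fin d → ℝ) → ℝ} (hc : Computes L w s e h) (e' : κ ≃ Fin m) {A : κ → ι → ℝ}
    (hA : ∀ a b, |A a b| ≤ 1) {v : ι → ℝ} (hv : ∀ b, |v b| ≤ 1) :
    Computes (L + 1) (max w m) (s + (Finset.univ.filter fun p : κ × ι => A p.1 p.2 ≠ 0).card +
        (Finset.univ.filter fun b => v b ≠ 0).card) e'
      fun k x => ∑ b, A k b * requ (h b x - v b) := by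
  obtain ⟨N, rfl, hd, hn, hw, hwt, hs, hN⟩ := hc
  set V : ι → Unit → ℝ := fun b _ => v b
  set eu : Unit ≃ Fin 1 := Equiv.ofUnique _ _
  set N' : ReQUNet := ⟨N.L + 1, Function.update N.arch (N.L + 2) m,
    Function.update N.W (N.L + 1) (natMatrix e' e A),
    Function.update N.v (N.L + 1) fun j => natMatrix e eu V j 0⟩ with hN'
  have harch : ∀ i, i ≠ N.L + 2 → N'.arch i = N.arch i := fun i hi => Function.update_of_ne hi _ _
  have hW : ∀ i, i ≠ N.L + 1 → N'.W i = N.W i := fun i hi => Function.update_of_ne hi _ _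
  have hv' : ∀ i, i ≠ N.L + 1 → N'.v i = N.v i := fun i hi => Function.update_of_ne hi _ _
  have harch' : N'.arch (N.L + 2) = m := Function.update_self _ _ _
  have hW' : N'.W (N.L + 1) = natMatrix e' e A := Function.update_self _ _ _
  have hv'' : N'.v (N.L + 1) = fun j => natMatrix e eu V j 0 := Function.update_self _ _ _
  have hVcard : ((Finset.range n).filter fun j => natMatrix e eu V j 0 ≠ 0).card ≤
      (Finset.univ.filter fun b => v b ≠ 0).card := by
    refine le_trans (Finset.card_le_card (t := (Finset.univ.filter fun b => v b ≠ 0).image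
      fun b => (e b : ℕ)) ?_) Finset.card_image_le
    intro j hj
    rw [Finset.mem_filter, Finset.mem_range] at hj
    refine Finset.mem_image.2 ⟨e.symm ⟨j, hj.1⟩, ?_, by simp⟩
    have := natMatrix_apply e eu V (e.symm ⟨j, hj.1⟩) ()
    rw [Equiv.apply_symm_apply] at this
    rw [Finset.mem_filter]
    exact ⟨Finset.mem_univ _, fun h0 => hj.2 (this.trans h0)⟩
  refine ⟨N', rfl, ?_, harch', ?_, ⟨?_, ?_⟩, ?_, ?_⟩
  · rw [harch 0 (by omega), hd]
  · refine Finset.sup_le fun i hi => ?_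
    rw [Finset.mem_range] at hi
    change i < N.L + 1 + 2 at hi
    by_cases h : i = N.L + 2
    · rw [h, harch']; exact le_max_right _ _
    · rw [harch i h]
      exact (Finset.le_sup (f := N.arch) (Finset.mem_range.2 (by omega))).trans
        (hw.trans (le_max_left _ _))
  · intro i hi j hj k hk
    change i ≤ N.L + 1 at hi
    by_cases h : i = N.L + 1
    · rw [h, hW']; exact natMatrix_mem _ _ hA _ _
    · rw [hW i h]
      rw [harch _ (by omega)] at hj hk
      exact hwt.1 i (by omega) j hj k hk
  · intro i h1 hi j hj
    change i ≤ N.L + 1 at hi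
    by_cases h : i = N.L + 1
    · rw [h, hv'']; exact natMatrix_mem e eu (A := V) (fun b _ => hv b) j 0
    · rw [hv' i h]
      rw [harch _ (by omega)] at hj
      exact hwt.2 i h1 (by omega) j hj
  · unfold ReQUNet.numNonzero at hs ⊢
    change (∑ i ∈ Finset.range (N.L + 1 + 1), _) + ∑ i ∈ Finset.Icc 1 (N.L + 1), _ ≤ _
    rw [Finset.sum_range_succ, Finset.sum_Icc_succ_top (by omega)]
    have h1 : ∑ i ∈ Finset.range (N.L + 1), ((Finset.range (N'.arch (i + 1)) ×ˢ
        Finset.range (N'.arch i)).filter fun p => N'.W i p.1 p.2 ≠ 0).card =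
        ∑ i ∈ Finset.range (N.L + 1), ((Finset.range (N.arch (i + 1)) ×ˢ
          Finset.range (N.arch i)).filter fun p => N.W i p.1 p.2 ≠ 0).card := by
      refine Finset.sum_congr rfl fun i hi => ?_
      rw [Finset.mem_range] at hi
      rw [harch i (by omega), harch (i + 1) (by omega), hW i (by omega)]
    have h2 : ∑ i ∈ Finset.Icc 1 N.L, ((Finset.range (N'.arch i)).filter
        fun j => N'.v i j ≠ 0).card =
        ∑ i ∈ Finset.Icc 1 N.L, ((Finset.range (N.arch i)).filter fun j => N.v i j ≠ 0).card := by
      refine Finset.sum_congr rfl fun i hi => ?_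
      rw [Finset.mem_Icc] at hi
      rw [harch i (by omega), hv' i (by omega)]
    rw [h1, h2, harch', harch _ (by omega), hW', hv'', hn]
    exact add_le_add_four hs (card_natMatrix_le e' e A) hVcard
  · intro x k
    have h0 := hidden_congr (N := N) (N' := N')
      (x := fun k => if h : k < d then x ⟨k, h⟩ else 0) (i := N.L) (fun k hk => harch k (by omega))
      (fun k hk => hW k (by omega)) fun k hk => hv' k (by omega)
    change ∑ l ∈ Finset.range (N'.arch (N.L + 1)), N'.W (N.L + 1) (e' k) l *
      requ (N'.hidden _ N.L l - N'.v (N.L + 1) l) = _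
    rw [h0, harch _ (by omega), hn, hW', hv'', sum_natMatrix_mul]
    refine Finset.sum_congr rfl fun b _ => ?_
    have h4 := hN x b
    rw [ReQUNet.evalVec, ReQUNet.eval] at h4
    rw [h4]
    exact congrArg (fun t => A k b * requ (h b x - t)) (natMatrix_apply e eu V b ())

/-- The weights with which four neurons are read out as the value of a unit. -/
noncomputable def readout : Fin 4 → ℝ := ![1 / 4, 1 / 4, -(1 / 4), -(1 / 4)]

theorem abs_readout_le (t : Fin 4) : |readout t| ≤ 1 := by
  fin_cases t <;> norm_num [readout, abs_le]

/-- The functions `P u` are read out from the neurons `(u, t)` in the hidden layer `L + 1` of a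
network whose first `L` hidden layers, and its weights up to the biases of the layer `L + 1`, obey
the bounds `w` on the width and `s` on the number of nonzero weights. -/
def UnitNet {U : Type} [Fintype U] (d L w s : ℕ) (P : U → (Fin d → ℝ) → ℝ) : Prop :=
  ∃ (h : U × Fin 4 → (Fin d → ℝ) → ℝ) (v : U × Fin 4 → ℝ) (s₀ : ℕ),
    Computes L w s₀ (Fintype.equivFin (U × Fin 4)) h ∧ (∀ b, |v b| ≤ 1) ∧
      s₀ + (Finset.univ.filter fun b => v b ≠ 0).card ≤ s ∧
      ∀ u x, P u x = ∑ t, readout t * requ (h (u, t) x - v (u, t))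

theorem Computes.mono {ι : Type} {n d L w w' s s' : ℕ} {e : ι ≃ Fin n} {h : ι → (Fin d → ℝ) → ℝ}
    (hc : Computes L w s e h) (hw : w ≤ w') (hs : s ≤ s') : Computes L w' s' e h := by
  obtain ⟨N, h1, h2, h3, h4, h5, h6, h7⟩ := hc
  exact ⟨N, h1, h2, h3, h4.trans hw, h5, h6.trans hs, h7⟩

theorem UnitNet.mono {U : Type} [Fintype U] {d L w w' s s' : ℕ} {P P' : U → (Fin d → ℝ) → ℝ}
    (hn : UnitNet d L w s P) (hw : w ≤ w') (hs : s ≤ s') (hP : ∀ u x, P u x = P' u x) :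
    UnitNet d L w' s' P' := by
  obtain ⟨h, v, s₀, h1, h2, h3, h4⟩ := hn
  exact ⟨h, v, s₀, h1.mono hw le_rfl, h2, h3.trans hs, fun u x => (hP u x).symm.trans (h4 u x)⟩

theorem unitNet_affine {U : Type} [Fintype U] {d : ℕ} (A : U × Fin 4 → Fin d → ℝ)
    (hA : ∀ a b, |A a b| ≤ 1) (b : U × Fin 4 → ℝ) (hb : ∀ a, |b a| ≤ 1) :
    UnitNet d 0 (max d (4 * Fintype.card U))
      ((Finset.univ.filter fun p : (U × Fin 4) × Fin d => A p.1 p.2 ≠ 0).card +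
        (Finset.univ.filter fun a => b a ≠ 0).card)
      fun u x => ∑ t, readout t * requ (∑ i, A (u, t) i * x i + b (u, t)) := by
  refine ⟨_, fun a => -b a, _, (computes_linear _ A hA).mono (le_of_eq ?_) le_rfl,
    fun a => by rw [abs_neg]; exact hb a, ?_, fun u x => ?_⟩
  · rw [Fintype.card_prod, Fintype.card_fin, mul_comm]
  · simp
  · simp

theorem sum_mul_sum_readout {U : Type} [Fintype U] (a : U → ℝ) (g : U × Fin 4 → ℝ) :
    ∑ p : U × Fin 4, a p.1 * readout p.2 * g p = ∑ u, a u * ∑ t, readout t * g (u, t) := by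
  rw [Fintype.sum_prod_type]
  exact Finset.sum_congr rfl fun u _ => by
    rw [Finset.mul_sum]
    exact Finset.sum_congr rfl fun t _ => mul_assoc _ _ _

theorem abs_mul_readout_le {a : ℝ} (ha : |a| ≤ 1) (t : Fin 4) : |a * readout t| ≤ 1 := by
  rw [abs_mul]
  exact mul_le_one₀ ha (abs_nonneg _) (abs_readout_le t)

theorem card_mul_readout_le {κ U : Type} [Fintype κ] [Fintype U] (A : κ → U → ℝ) :
    (Finset.univ.filter fun p : κ × U × Fin 4 => A p.1 p.2.1 * readout p.2.2 ≠ 0).card ≤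
      4 * (Finset.univ.filter fun p : κ × U => A p.1 p.2 ≠ 0).card := by
  calc _ ≤ (((Finset.univ.filter fun p : κ × U => A p.1 p.2 ≠ 0) ×ˢ
        (Finset.univ : Finset (Fin 4))).image fun p => (p.1.1, p.1.2, p.2)).card := by
        refine Finset.card_le_card ?_
        rintro ⟨k, u, t⟩ h
        rw [Finset.mem_filter] at h
        refine Finset.mem_image.2 ⟨((k, u), t), ?_, rfl⟩
        simp only [Finset.mem_product, Finset.mem_filter, Finset.mem_univ, true_and, and_true]
        exact left_ne_zero_of_mul h.2
    _ ≤ _ := Finset.card_image_le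
    _ = _ := by rw [Finset.card_product, Finset.card_univ, Fintype.card_fin, mul_comm]

theorem UnitNet.affine {U U' : Type} [Fintype U] [Fintype U'] {d L w s : ℕ}
    {P : U → (Fin d → ℝ) → ℝ} (hn : UnitNet d L w s P) (A : U' × Fin 4 → U → ℝ)
    (hA : ∀ a b, |A a b| ≤ 1) (b : U' × Fin 4 → ℝ) (hb : ∀ a, |b a| ≤ 1) :
    UnitNet d (L + 1) (max w (4 * Fintype.card U'))
      (s + 4 * (Finset.univ.filter fun p : (U' × Fin 4) × U => A p.1 p.2 ≠ 0).card +
        (Finset.univ.filter fun a => b a ≠ 0).card)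
      fun u x => ∑ t, readout t * requ (∑ u', A (u, t) u' * P u' x + b (u, t)) := by
  obtain ⟨h, v, s₀, h1, h2, h3, h4⟩ := hn
  refine ⟨_, fun a => -b a, _, (h1.append (Fintype.equivFin _)
    (A := fun k p => A k p.1 * readout p.2) (fun k p => abs_mul_readout_le (hA _ _) _) h2).mono
      (le_of_eq ?_) le_rfl,
    fun a => by rw [abs_neg]; exact hb a, ?_, fun u x => ?_⟩
  · rw [Fintype.card_prod, Fintype.card_fin, mul_comm 4]
  · have := card_mul_readout_le A
    simp only [ne_eq, neg_eq_zero] at this h3 ⊢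
    omega
  · refine Finset.sum_congr rfl fun t _ => ?_
    rw [sub_neg_eq_add, sum_mul_sum_readout (fun u' => A (u, t) u') fun p => requ (h p x - v p)]
    simp_rw [h4]

theorem UnitNet.output {U : Type} [Fintype U] {d L w s p : ℕ}
    {P : U → (Fin d → ℝ) → ℝ} (hn : UnitNet d L w s P) (A : Fin p → U → ℝ)
    (hA : ∀ a b, |A a b| ≤ 1) :
    Computes (L + 1) (max w p) (s + 4 * (p * Fintype.card U)) (Equiv.refl (Fin p))
      fun k x => ∑ u, A k u * P u x := by
  obtain ⟨h, v, s₀, h1, h2, h3, h4⟩ := hn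
  obtain ⟨N, g1, g2, g3, g4, g5, g6, g7⟩ := h1.append (Equiv.refl (Fin p))
    (A := fun k q => A k q.1 * readout q.2) (fun k q => abs_mul_readout_le (hA _ _) _) h2
  refine ⟨N, g1, g2, g3, g4, g5, g6.trans ?_, fun x k => (g7 x k).trans ?_⟩
  · have := card_mul_readout_le A
    have h5 : (Finset.univ.filter fun p : Fin p × U => A p.1 p.2 ≠ 0).card ≤ p * Fintype.card U :=
      (Finset.card_le_univ _).trans (by simp)
    omega
  · dsimp only
    rw [sum_mul_sum_readout (fun u => A k u) fun p => requ (h p x - v p)]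
    simp_rw [h4]

/-- The operations performed by a single unit. -/
inductive Gate (U : Type) : Type
  /-- the product of the value of one unit with an affine function of the value of another -/
  | mul (a a' : U) (α τ : ℝ) : Gate U
  /-- half the squared positive part of an affine function of the value of a unit -/
  | sq (a : U) (α τ : ℝ) : Gate U

namespace Gate

variable {U : Type}

/-- The value computed by a gate from the values of the units. -/
noncomputable def value (P : U → ℝ) : Gate U → ℝ
  | mul a a' α τ => P a * (α * P a' + τ)
  | sq a α τ => requ (α * P a + τ) / 2

/-- The weights of a gate are admissible. -/
def Bounded : Gate U → Prop
  | mul a a' α τ => |α| ≤ 1 ∧ |τ| ≤ 1 ∧ (a = a' → α = 0)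
  | sq _ α τ => |α| ≤ 1 ∧ |τ| ≤ 1

/-- The weights of the neurons of a gate. -/
noncomputable def row (t : Fin 4) : Gate U → U → ℝ
  | mul a a' α _ => Pi.single a (![1, -1, 1, -1] t) + Pi.single a' (![1, -1, -1, 1] t * α)
  | sq a α _ => Pi.single a (![1, 1, 0, 0] t * α)

/-- The biases of the neurons of a gate. -/
noncomputable def bias (t : Fin 4) : Gate U → ℝ
  | mul _ _ _ τ => ![1, -1, -1, 1] t * τ
  | sq _ _ τ => ![1, 1, 0, 0] t * τ

theorem abs_bias_le {g : Gate U} (hg : g.Bounded) (t : Fin 4) : |g.bias t| ≤ 1 := by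
  cases g with
  | mul a a' α τ => fin_cases t <;> simpa [bias] using hg.2.1
  | sq a α τ => fin_cases t <;> simp [bias, hg.2]

theorem abs_row_le {g : Gate U} (hg : g.Bounded) (t : Fin 4) (u : U) : |g.row t u| ≤ 1 := by
  cases g with
  | mul a a' α τ =>
    obtain ⟨h1, -, h3⟩ := hg
    simp only [row, Pi.add_apply, Pi.single_apply]
    by_cases h : u = a
    · by_cases h' : u = a'
      · rw [h3 (h.symm.trans h'), if_pos h, if_pos h']
        fin_cases t <;> simp
      · rw [if_pos h, if_neg h']
        fin_cases t <;> simp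
    · rw [if_neg h]
      split_ifs
      · fin_cases t <;> simpa using h1
      · simp
  | sq a α τ =>
    simp only [row, Pi.single_apply]
    split_ifs
    · fin_cases t <;> simp [hg.1]
    · simp

theorem card_row_le [Fintype U] (g : Gate U) (t : Fin 4) :
    (Finset.univ.filter fun u => g.row t u ≠ 0).card ≤ 2 := by
  cases g with
  | mul a a' α τ =>
    refine (Finset.card_le_card (t := {a, a'}) fun u hu => ?_).trans Finset.card_le_two
    rw [Finset.mem_filter] at hu
    by_contra h
    rw [Finset.mem_insert, Finset.mem_singleton, not_or] at h
    exact hu.2 (by simp [row, h])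
  | sq a α τ =>
    refine (Finset.card_le_card (t := {a, a}) fun u hu => ?_).trans Finset.card_le_two
    rw [Finset.mem_filter] at hu
    by_contra h
    rw [Finset.mem_insert, Finset.mem_singleton, or_self] at h
    exact hu.2 (by simp [row, h])

end Gate

theorem requ_add_requ_neg (t : ℝ) : requ t + requ (-t) = t ^ 2 := by
  unfold requ
  rcases le_total t 0 with h | h
  · rw [max_eq_right h, max_eq_left (by linarith)]; ring
  · rw [max_eq_left h, max_eq_right (by linarith)]; ring

theorem sum_readout_gate {U : Type} [Fintype U] (g : Gate U) (P : U → ℝ) :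
    ∑ t, readout t * requ (∑ u, g.row t u * P u + g.bias t) = g.value P := by
  have hs : ∀ (a : U) (c : ℝ), ∑ u, (Pi.single a c : U → ℝ) u * P u = c * P a := by
    intro a c
    simp [Pi.single_apply]
  cases g with
  | mul a a' α τ =>
    simp only [Gate.row, Gate.bias, Pi.add_apply, add_mul, Finset.sum_add_distrib, hs, Gate.value,
      Fin.sum_univ_four, readout]
    have h1 := requ_add_requ_neg (P a + (α * P a' + τ))
    have h2 := requ_add_requ_neg (P a - (α * P a' + τ))
    simp
    ring_nf at h1 h2 ⊢
    linarith
  | sq a α τ =>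
    simp only [Gate.row, Gate.bias, hs, Gate.value, Fin.sum_univ_four, readout]
    have h0 : requ 0 = 0 := by simp [requ]
    simp [h0]
    ring

theorem card_gate_weights_le {U U' : Type} [Fintype U] [Fintype U'] (G : U' → Gate U) :
    (Finset.univ.filter fun p : (U' × Fin 4) × U => (G p.1.1).row p.1.2 p.2 ≠ 0).card +
      (Finset.univ.filter fun k : U' × Fin 4 => (G k.1).bias k.2 ≠ 0).card ≤
      12 * Fintype.card U' ∧
    4 * (Finset.univ.filter fun p : (U' × Fin 4) × U => (G p.1.1).row p.1.2 p.2 ≠ 0).card +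
      (Finset.univ.filter fun k : U' × Fin 4 => (G k.1).bias k.2 ≠ 0).card ≤
      36 * Fintype.card U' := by
  have h1 : (Finset.univ.filter fun p : (U' × Fin 4) × U => (G p.1.1).row p.1.2 p.2 ≠ 0).card ≤
      8 * Fintype.card U' := by
    rw [Finset.card_filter, Fintype.sum_prod_type]
    calc _ ≤ ∑ k : U' × Fin 4, 2 := Finset.sum_le_sum fun k _ => by
          rw [← Finset.card_filter]
          exact Gate.card_row_le (G k.1) k.2
      _ = _ := by simp; ring
  have h2 : (Finset.univ.filter fun k : U' × Fin 4 => (G k.1).bias k.2 ≠ 0).card ≤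
      4 * Fintype.card U' :=
    (Finset.card_le_univ _).trans (by simp; omega)
  omega

theorem UnitNet.gates {U U' : Type} [Fintype U] [Fintype U'] {d L w s : ℕ}
    {P : U → (Fin d → ℝ) → ℝ} (hn : UnitNet d L w s P) (G : U' → Gate U)
    (hG : ∀ u, (G u).Bounded) :
    UnitNet d (L + 1) (max w (4 * Fintype.card U')) (s + 36 * Fintype.card U')
      fun u x => (G u).value fun u' => P u' x := by
  refine (hn.affine (fun k => (G k.1).row k.2) (fun k u => Gate.abs_row_le (hG _) _ _)
    (fun k => (G k.1).bias k.2) fun k => Gate.abs_bias_le (hG _) _).mono le_rfl ?_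
    fun u x => sum_readout_gate (G u) fun u' => P u' x
  rw [add_assoc]
  exact Nat.add_le_add_left (card_gate_weights_le G).2 s

/-- A rapidly growing sequence generated by square gates. -/
noncomputable def amp (K : ℕ) : ℕ → ℝ
  | 0 => requ (K / 2 + 1) / 2
  | n + 1 => requ (1 * amp K n + 1) / 2

theorem requ_one : requ 1 = 1 := by simp [requ]

theorem unitNet_input {d K : ℕ} (hd : 0 < d) :
    UnitNet d 0 (4 * (d + K)) (12 * (d + K))
      (Sum.elim (fun i x => x i) (fun (_ : Fin K) _ => 1 / 2) :
        Fin d ⊕ Fin K → (Fin d → ℝ) → ℝ) := by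
  set G : Fin d ⊕ Fin K → Gate (Fin d) :=
    Sum.elim (fun i => Gate.mul i i 0 1) fun _ => Gate.sq ⟨0, hd⟩ 0 1 with hG
  have hb : ∀ u, (G u).Bounded := by
    rintro (i | k) <;> simp [hG, Gate.Bounded]
  refine (unitNet_affine (fun k => (G k.1).row k.2) (fun k u => Gate.abs_row_le (hb _) _ _)
    (fun k => (G k.1).bias k.2) fun k => Gate.abs_bias_le (hb _) _).mono ?_ ?_ ?_
  · simp; omega
  · have h := (card_gate_weights_le G).1
    simp only [Fintype.card_sum, Fintype.card_fin] at h
    exact h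
  · rintro (i | k) x
    · rw [sum_readout_gate (G (Sum.inl i)) x]
      simp [hG, Gate.value]
    · rw [sum_readout_gate (G (Sum.inr k)) x]
      simp [hG, Gate.value, requ_one]

theorem unitNet_coord_amp {d K : ℕ} (hd : 0 < d) (n : ℕ) :
    UnitNet d (n + 1) (4 * (d + K) + 4) (28 * K + 36 * (n + 2) * (d + 1))
      (Sum.elim (fun i x => x i) (fun _ _ => amp K n) :
        Fin d ⊕ Unit → (Fin d → ℝ) → ℝ) := by
  induction n with
  | zero =>
    set A : (Fin d ⊕ Unit) × Fin 4 → Fin d ⊕ Fin K → ℝ := fun k => Sum.elim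
      (fun i => (Gate.mul (Sum.inl i) (Sum.inl i) 0 1 : Gate (Fin d ⊕ Fin K)).row k.2)
      (fun _ => Sum.elim 0 fun _ => ![1, 1, 0, 0] k.2) k.1 with hA
    set b : (Fin d ⊕ Unit) × Fin 4 → ℝ := fun k => Sum.elim
      (fun i => (Gate.mul (Sum.inl i) (Sum.inl i) 0 1 : Gate (Fin d ⊕ Fin K)).bias k.2)
      (fun _ => ![1, 1, 0, 0] k.2) k.1 with hb
    have hG : ∀ i, (Gate.mul (Sum.inl i) (Sum.inl i) 0 1 : Gate (Fin d ⊕ Fin K)).Bounded := by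
      simp [Gate.Bounded]
    refine ((unitNet_input (K := K) hd).affine A ?_ b ?_).mono ?_ ?_ ?_
    · rintro ⟨i | k, t⟩ u
      · exact Gate.abs_row_le (hG i) t u
      · rcases u with u | u
        · simp [hA]
        · fin_cases t <;> simp [hA]
    · rintro ⟨i | k, t⟩
      · exact Gate.abs_bias_le (hG i) t
      · fin_cases t <;> simp [hb]
    · simp; omega
    · have h1 : (Finset.univ.filter fun p : ((Fin d ⊕ Unit) × Fin 4) × (Fin d ⊕ Fin K) =>
          A p.1 p.2 ≠ 0).card ≤ 8 * d + 4 * K := by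
        rw [Finset.card_filter, Fintype.sum_prod_type, Fintype.sum_prod_type, Fintype.sum_sum_type]
        refine add_le_add ?_ ?_
        · calc _ ≤ ∑ i : Fin d, ∑ t : Fin 4, 2 :=
                Finset.sum_le_sum fun i _ => Finset.sum_le_sum fun t _ => by
                  rw [← Finset.card_filter]
                  exact Gate.card_row_le
                    (Gate.mul (Sum.inl i) (Sum.inl i) 0 1 : Gate (Fin d ⊕ Fin K)) t
            _ = _ := by simp; ring
        · calc _ ≤ ∑ i : Unit, ∑ t : Fin 4, K :=
                Finset.sum_le_sum fun i _ => Finset.sum_le_sum fun t _ => by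
                  rw [Fintype.sum_sum_type]
                  calc _ ≤ ∑ i : Fin d, 0 + ∑ i : Fin K, 1 := by
                        refine add_le_add (Finset.sum_le_sum fun i _ => by simp [hA])
                          (Finset.sum_le_sum fun i _ => by split_ifs <;> simp)
                    _ = K := by simp
            _ = _ := by simp
      have h2 : (Finset.univ.filter fun a => b a ≠ 0).card ≤ 4 * (d + 1) :=
        (Finset.card_le_univ _).trans (by simp; omega)
      omega
    · rintro (i | k) x
      · exact (sum_readout_gate (Gate.mul (Sum.inl i) (Sum.inl i) 0 1) _).trans
          (by simp [Gate.value])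
      · simp [Fin.sum_univ_four, hA, hb, amp, readout, requ]
        ring_nf
  | succ n ih =>
    refine (ih.gates (Sum.elim (fun i => Gate.mul (Sum.inl i) (Sum.inl i) 0 1)
      (fun _ => Gate.sq (Sum.inr ()) 1 1) : Fin d ⊕ Unit → Gate (Fin d ⊕ Unit)) ?_).mono ?_ ?_ ?_
    · rintro (i | k) <;> simp [Gate.Bounded]
    · simp; omega
    · simp; ring_nf; omega
    · rintro (i | k) x
      · simp [Gate.value]
      · simp [Gate.value, amp]

/-- The normalised distance to the left end of the support of a spline factor. -/
noncomputable def offset {d q K : ℕ} (x : Fin d → ℝ) (u : Fin d × Fin (K + q)) : ℝ :=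
  1 / q * x u.1 + -(((u.2 : ℝ) - q) / K / q)

theorem abs_knot_div_le {q K : ℕ} (hq : 0 < q) (hK : 0 < K) (j : Fin (K + q)) :
    |-(((j : ℝ) - q) / K / q)| ≤ 1 := by
  have hq' : (1 : ℝ) ≤ q := by exact_mod_cast hq
  have hK' : (1 : ℝ) ≤ K := by exact_mod_cast hK
  have hj : (j : ℝ) ≤ K + q := by exact_mod_cast j.2.le
  have hj' : (0 : ℝ) ≤ j := by positivity
  rw [abs_neg, div_div, abs_div, abs_of_pos (by positivity : (0 : ℝ) < K * q),
    div_le_one (by positivity), abs_le]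
  constructor <;> nlinarith

theorem unitNet_powers {d q K : ℕ} (hd : 0 < d) (hq : 0 < q) (hK : 0 < K) (n r : ℕ) :
    UnitNet d (n + 1 + (r + 1)) (4 * (d + K) + 4 + 4 * (d * (K + q)))
      (28 * K + 36 * (n + r + 3) * (d + 1) + 36 * (r + 1) * (d * (K + q)))
      (Sum.elim (Sum.elim (fun i x => x i) (fun _ _ => amp K (n + (r + 1))))
        (fun u x => max (offset x u) 0 ^ (r + 2) / 2) :
        (Fin d ⊕ Unit) ⊕ (Fin d × Fin (K + q)) → (Fin d → ℝ) → ℝ) := by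
  have hq1 : |1 / (q : ℝ)| ≤ 1 := by
    rw [abs_of_nonneg (by positivity)]
    exact div_le_one_of_le₀ (by exact_mod_cast hq) (by positivity)
  induction r with
  | zero =>
    refine ((unitNet_coord_amp (K := K) hd n).gates (Sum.elim (Sum.elim
      (fun i => Gate.mul (Sum.inl i) (Sum.inl i) 0 1) (fun _ => Gate.sq (Sum.inr ()) 1 1))
      (fun u => Gate.sq (Sum.inl u.1) (1 / q) (-(((u.2 : ℝ) - q) / K / q))) :
      (Fin d ⊕ Unit) ⊕ (Fin d × Fin (K + q)) → Gate (Fin d ⊕ Unit)) ?_).mono ?_ ?_ ?_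
    · rintro ((i | k) | u)
      · simp [Gate.Bounded]
      · simp [Gate.Bounded]
      · exact ⟨hq1, abs_knot_div_le hq hK u.2⟩
    · simp; omega
    · simp; ring_nf; omega
    · rintro ((i | k) | u) x
      · simp [Gate.value]
      · simp [Gate.value, amp]
      · simp [Gate.value, requ, offset]
  | succ r ih =>
    refine (ih.gates (Sum.elim (Sum.elim
      (fun i => Gate.mul (Sum.inl (Sum.inl i)) (Sum.inl (Sum.inl i)) 0 1)
      (fun _ => Gate.sq (Sum.inl (Sum.inr ())) 1 1))
      (fun u => Gate.mul (Sum.inr u) (Sum.inl (Sum.inl u.1)) (1 / q)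
        (-(((u.2 : ℝ) - q) / K / q))) :
      (Fin d ⊕ Unit) ⊕ (Fin d × Fin (K + q)) →
        Gate ((Fin d ⊕ Unit) ⊕ (Fin d × Fin (K + q)))) ?_).mono ?_ ?_ ?_
    · rintro ((i | k) | u)
      · simp [Gate.Bounded]
      · simp [Gate.Bounded]
      · exact ⟨hq1, abs_knot_div_le hq hK u.2, by simp⟩
    · simp; omega
    · simp; ring_nf; omega
    · rintro ((i | k) | u) x
      · simp [Gate.value]
      · simp [Gate.value, amp]
      · change max (offset x u) 0 ^ (r + 2) / 2 * offset x u = max (offset x u) 0 ^ (r + 1 + 2) / 2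
        rcases le_total (offset x u) 0 with h | h
        · rw [max_eq_right h]; simp
        · rw [max_eq_left h]; ring

theorem prod_range_pairs (n : ℕ) (F : ℕ → ℝ) :
    ∏ s ∈ Finset.range ((n + 1) / 2), (if 2 * s + 1 < n then F (2 * s) * F (2 * s + 1)
      else F (2 * s)) = ∏ s ∈ Finset.range n, F s := by
  set F' : ℕ → ℝ := fun s => if s < n then F s else 1 with hF'
  have h1 : ∀ m, ∏ s ∈ Finset.range (2 * m), F' s =
      ∏ s ∈ Finset.range m, (F' (2 * s) * F' (2 * s + 1)) := by
    intro m
    induction m with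
    | zero => simp
    | succ m ih =>
      rw [Finset.prod_range_succ, ← ih, mul_add, Finset.prod_range_succ, Finset.prod_range_succ,
        mul_assoc]
  have h2 : ∏ s ∈ Finset.range n, F s = ∏ s ∈ Finset.range (2 * ((n + 1) / 2)), F' s := by
    rw [← Finset.prod_subset (Finset.range_subset_range.2 (by omega : n ≤ 2 * ((n + 1) / 2)))
      fun s _ hs => if_neg (by simpa using hs)]
    exact Finset.prod_congr rfl fun s hs => (if_pos (Finset.mem_range.1 hs)).symm
  rw [h2, h1]
  refine Finset.prod_congr rfl fun s hs => ?_
  rw [Finset.mem_range] at hs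
  simp only [hF']
  rw [if_pos (by omega : 2 * s < n)]
  split_ifs <;> simp

theorem UnitNet.prod {J : Type} [Fintype J] {d : ℕ} (n : ℕ) :
    0 < n → ∀ {L w s : ℕ} {P : J × Fin n → (Fin d → ℝ) → ℝ}, UnitNet d L w s P →
      UnitNet d (L + Nat.clog 2 n) (max w (4 * (Fintype.card J * n)))
        (s + 72 * (Fintype.card J * (n - 1)))
        fun (u : J × Fin 1) x => ∏ i, P (u.1, i) x := by
  induction n using Nat.strong_induction_on with
  | _ n ih =>
    intro hn L w s P hP
    rcases Nat.lt_or_ge n 2 with h2 | h2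
    · obtain rfl : n = 1 := by omega
      refine hP.mono (le_max_left _ _) (by simp) ?_
      rintro ⟨j, i⟩ x
      obtain rfl : i = 0 := Subsingleton.elim _ _
      simp
    · set m := (n + 1) / 2 with hm
      have hlt : m < n := by omega
      set G : J × Fin m → Gate (J × Fin n) := fun u =>
        if h : 2 * (u.2 : ℕ) + 1 < n then
          Gate.mul (u.1, ⟨2 * u.2, by omega⟩) (u.1, ⟨2 * u.2 + 1, h⟩) 1 0
        else Gate.mul (u.1, ⟨2 * u.2, by omega⟩) (u.1, ⟨2 * u.2, by omega⟩) 0 1 with hG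
      have hb : ∀ u, (G u).Bounded := by
        intro u
        simp only [hG]
        split_ifs <;> simp [Gate.Bounded]
      have h := ih m hlt (by omega) (hP.gates G hb)
      rw [show L + Nat.clog 2 n = L + 1 + Nat.clog 2 m by
        rw [Nat.clog_of_two_le one_lt_two h2, show n + 2 - 1 = n + 1 from rfl, ← hm]; omega]
      refine h.mono ?_ ?_ ?_
      · have : Fintype.card J * m ≤ Fintype.card J * n := Nat.mul_le_mul_left _ hlt.le
        simp only [Fintype.card_prod, Fintype.card_fin]
        omega
      · simp only [Fintype.card_prod, Fintype.card_fin]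
        have : Fintype.card J * (m + 2 * (m - 1)) ≤ Fintype.card J * (2 * (n - 1)) :=
          Nat.mul_le_mul_left _ (by omega)
        nlinarith
      · rintro ⟨j, i⟩ x
        have h3 := prod_range_pairs n fun k => if h : k < n then P (j, ⟨k, h⟩) x else 1
        rw [← hm, Finset.prod_range, Finset.prod_range] at h3
        refine Eq.trans ?_ (h3.trans ?_)
        · refine Finset.prod_congr rfl fun k _ => ?_
          simp only [hG]
          rw [dif_pos (by omega : 2 * (k : ℕ) < n)]
          split_ifs with h4
          · simp [Gate.value]
          · simp [Gate.value]
        · exact Finset.prod_congr rfl fun k _ => by simp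

theorem amp_nonneg (K n : ℕ) : 0 ≤ amp K n := by
  cases n <;> simp only [amp, requ] <;> positivity

theorem amp_succ (K n : ℕ) : amp K (n + 1) = (amp K n + 1) ^ 2 / 2 := by
  have := amp_nonneg K n
  rw [amp, requ, max_eq_left (by linarith), one_mul]

theorem pow_two_pow_le_amp (K n : ℕ) : (K : ℝ) ^ 2 ^ n ≤ amp K (n + 1) / 2 := by
  induction n with
  | zero =>
    have hK : (0 : ℝ) ≤ K := Nat.cast_nonneg K
    rw [amp_succ, amp, requ, max_eq_left (by linarith)]
    obtain ⟨s, hs, hsK⟩ : ∃ s : ℝ, 0 ≤ s ∧ s ^ 2 = K := ⟨√K, Real.sqrt_nonneg _, Real.sq_sqrt hK⟩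
    rw [← hsK]
    have h : s ≤ ((s ^ 2 / 2 + 1) ^ 2 / 2 + 1) / 2 := by
      nlinarith [sq_nonneg (s ^ 2 - 3 / 2), sq_nonneg (s - 5 / 4)]
    nlinarith
  | succ n ih =>
    rw [amp_succ, pow_succ, pow_mul]
    have h0 : (0 : ℝ) ≤ (K : ℝ) ^ 2 ^ n := by positivity
    nlinarith

theorem exists_net_splineJet {p d q K n : ℕ} (hd : 0 < d) (hq : 2 ≤ q) (hK : 0 < K)
    (c : Fin p → (Fin d → Fin (K + q)) → ℝ)
    (hc : ∀ i m, |c i m| * (2 * ((q : ℝ) ^ q / q.factorial)) ^ d ≤ amp K (n + (q - 1)) ^ d) :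
    ∃ N : ReQUNet, N.L = n + q + 2 + Nat.clog 2 d ∧ N.arch 0 = d ∧ N.arch (N.L + 1) = p ∧
      N.width ≤ max (max (4 * (d + K) + 4 + 4 * (d * (K + q))) (4 * ((K + q) ^ d * d))) p ∧
      N.weightsIn (Set.Icc (-1) 1) ∧
      N.numNonzero ≤ 28 * K + 36 * (n + q + 1) * (d + 1) + 36 * (q - 1) * (d * (K + q)) +
        36 * ((K + q) ^ d * d) + 72 * ((K + q) ^ d * (d - 1)) + 4 * (p * (K + q) ^ d) ∧
      ∀ x i, N.evalVec d x (i : Fin p) = splineJet q K (c i) 0 x := by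
  set a := amp K (n + (q - 1)) with ha
  have ha0 : 0 < a := by
    refine lt_of_lt_of_le ?_ (le_of_eq (congrArg (amp K) (by omega : n + (q - 2) + 1 = n + (q - 1))))
    rw [amp_succ]
    have := amp_nonneg K (n + (q - 2))
    positivity
  have h1 := unitNet_powers (q := q) hd (by omega) hK n (q - 2)
  rw [show n + (q - 2) + 3 = n + q + 1 by omega, show q - 2 + 1 = q - 1 by omega,
    show q - 2 + 2 = q by omega, ← ha] at h1
  have h2 := h1.gates (fun u : (Fin d → Fin (K + q)) × Fin d =>
    Gate.mul (Sum.inr (u.2, u.1 u.2)) (Sum.inl (Sum.inr ())) 1 0) (by simp [Gate.Bounded])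
  obtain ⟨N, g1, g2, g3, g4, g5, g6, g7⟩ := (h2.prod d hd).output
    (fun i u => c i u.1 * (2 * ((q : ℝ) ^ q / q.factorial) / a) ^ d) (fun i u => by
      rw [div_pow, ← mul_div_assoc, abs_div, abs_mul, abs_of_nonneg (a := (2 * _) ^ d)
        (by positivity), abs_of_pos (by positivity : 0 < a ^ d)]
      exact div_le_one_of_le₀ (hc i u.1) (by positivity))
  simp only [Fintype.card_prod, Fintype.card_fin, Fintype.card_pi, Finset.prod_const,
    Finset.card_univ, mul_one] at g1 g4 g6
  refine ⟨N, g1.trans (by omega), g2, g3, g4.trans (by omega), g5, g6, fun x i => ?_⟩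
  refine (g7 x i).trans ?_
  refine (Fintype.sum_prod_type _).trans (Finset.sum_congr rfl fun m _ => ?_)
  rw [Fintype.sum_unique, mul_assoc]
  congr 1
  rw [← Fin.prod_const, ← Finset.prod_mul_distrib]
  refine Finset.prod_congr rfl fun s _ => ?_
  have hq0 : (0 : ℝ) < q := by exact_mod_cast (by omega : 0 < q)
  have h3 : max (offset x (s, m s)) 0 = max (x s - ((m s : ℝ) - q) / K) 0 / q := by
    rw [← max_div_div_right hq0.le, zero_div, offset]
    congr 1
    ring
  change 2 * ((q : ℝ) ^ q / q.factorial) / a * (max (offset x (s, m s)) 0 ^ q / 2 * (1 * a + 0)) = _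
  rw [h3, Pi.zero_apply, Nat.sub_zero, tpow_eq_max_pow (by omega), div_pow, add_zero, one_mul]
  generalize max (x s - ((m s : ℝ) - q) / K) 0 ^ q = y
  field_simp

theorem coeff_mul_le_amp {d q K M : ℕ} {H C : ℝ} (hd : 0 < d) (hq : 2 ≤ q) (hK : 2 ≤ K)
    (hM : 3 ≤ M) (hHM : H ≤ 2 ^ 2 ^ M)
    (hC : C ≤ H * Real.exp (d * q) * ((K + q : ℝ) * ((K : ℝ) ^ q * 2 ^ (q + 1))) ^ d) :
    C * (2 * ((q : ℝ) ^ q / q.factorial)) ^ d ≤ amp K (q + 2 * M + (q - 1)) ^ d := by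
  have hK' : (2 : ℝ) ≤ K := by exact_mod_cast hK
  have hK0 : (0 : ℝ) < K := by linarith
  have he : Real.exp q ≤ (K : ℝ) ^ (2 * q) := by
    rw [pow_mul, ← mul_one (q : ℝ), Real.exp_nat_mul]
    exact pow_le_pow_left₀ (Real.exp_pos _).le (by nlinarith [Real.exp_one_lt_d9]) _
  have h1 : (q : ℝ) ^ q / q.factorial ≤ (K : ℝ) ^ (2 * q) :=
    (Real.pow_div_factorial_le_exp (q : ℝ) (Nat.cast_nonneg q) q).trans he
  have h2 : (2 : ℝ) ^ (q + 1) ≤ (K : ℝ) ^ (q + 1) := pow_le_pow_left₀ zero_le_two hK' _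
  have h3 : (K + q : ℝ) ≤ (K : ℝ) ^ (q + 1) := by
    have h4 : ((q + 1 : ℕ) : ℝ) ≤ ((2 ^ q : ℕ) : ℝ) := by exact_mod_cast Nat.lt_two_pow_self
    push_cast at h4
    have h5 : (2 : ℝ) ^ q ≤ (K : ℝ) ^ q := pow_le_pow_left₀ zero_le_two hK' _
    rw [pow_succ]
    nlinarith [Nat.cast_nonneg (α := ℝ) q]
  have h4 : H ≤ ((K : ℝ) ^ 2 ^ M) ^ d := by
    refine (hHM.trans (pow_le_pow_left₀ zero_le_two hK' _)).trans (le_self_pow₀ ?_ hd.ne')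
    exact one_le_pow₀ (by linarith)
  have h5 : 2 ^ M + 2 * q + (q + 1) + q + (q + 1) + 2 * q ≤ 2 ^ (2 * q - 2 + 2 * M) := by
    have hb : 8 ≤ 2 ^ M := by
      calc 8 = 2 ^ 3 := by norm_num
        _ ≤ 2 ^ M := Nat.pow_le_pow_right (by norm_num) hM
    have hq' : q ≤ 2 ^ (2 * q - 2) :=
      le_trans (by omega) (Nat.lt_two_pow_self (n := 2 * q - 2))
    rw [pow_add, mul_comm 2 M, pow_mul]
    generalize 2 ^ M = b at hb ⊢
    generalize 2 ^ (2 * q - 2) = a at hq' ⊢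
    have h6 : 8 * b ≤ b ^ 2 := by nlinarith
    have h7 : a * (8 * b) ≤ a * b ^ 2 := Nat.mul_le_mul_left _ h6
    have h8 : q * b ≤ a * b := Nat.mul_le_mul_right _ hq'
    have h9 : q * 8 ≤ q * b := Nat.mul_le_mul_left _ hb
    have h10 : 2 * b ≤ q * b := Nat.mul_le_mul_right _ hq
    nlinarith
  have h6 := pow_two_pow_le_amp K (2 * q - 2 + 2 * M)
  rw [show 2 * q - 2 + 2 * M + 1 = q + 2 * M + (q - 1) by omega] at h6
  have h7 : (K : ℝ) ^ 2 ^ M * (K : ℝ) ^ (2 * q) * ((K : ℝ) ^ (q + 1) * ((K : ℝ) ^ q *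
      (K : ℝ) ^ (q + 1))) * (2 * (K : ℝ) ^ (2 * q)) ≤ amp K (q + 2 * M + (q - 1)) := by
    have h8 : (K : ℝ) ^ (2 ^ M + 2 * q + (q + 1) + q + (q + 1) + 2 * q) ≤
        (K : ℝ) ^ 2 ^ (2 * q - 2 + 2 * M) := pow_le_pow_right₀ (by linarith) h5
    simp only [pow_add] at h8 h6 ⊢
    linarith
  refine le_trans ?_ (pow_le_pow_left₀ (by positivity) h7 d)
  rw [mul_pow _ (2 * _), mul_pow _ ((K : ℝ) ^ (q + 1) * _), mul_pow ((K : ℝ) ^ 2 ^ M)]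
  have h9 : Real.exp (d * q) ≤ ((K : ℝ) ^ (2 * q)) ^ d := by
    rw [Real.exp_nat_mul]
    exact pow_le_pow_left₀ (Real.exp_pos _).le he d
  refine mul_le_mul (hC.trans ?_) (by gcongr) (by positivity) (by positivity)
  refine mul_le_mul (mul_le_mul h4 h9 (Real.exp_pos _).le (by positivity)) (by gcongr)
    (by positivity) (by positivity)

theorem two_mul_mul_le_pow {d X : ℕ} (hd : 2 ≤ d) (hX : 4 ≤ X) : 2 * (d * X) ≤ X ^ d := by
  induction d, hd using Nat.le_induction with
  | base => nlinarith
  | succ d hd ih =>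
    rw [pow_succ]
    have h1 : X ^ d * 4 ≤ X ^ d * X := Nat.mul_le_mul_left _ hX
    have h2 : 2 * X ≤ d * X := Nat.mul_le_mul_right _ hd
    rw [add_mul]
    omega

theorem width_budget {d q K p : ℕ} (hd : 0 < d) (hq : 2 ≤ q) (hK : 2 ≤ K) :
    max (max (4 * (d + K) + 4 + 4 * (d * (K + q))) (4 * ((K + q) ^ d * d))) p ≤
      max (4 * d * (K + q) ^ d) (max (12 * (K + 2 * q + 1)) p) := by
  have h0 : 4 * ((K + q) ^ d * d) = 4 * d * (K + q) ^ d := by ring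
  rw [h0]
  rcases Nat.lt_or_ge d 2 with h | h
  · obtain rfl : d = 1 := by omega
    omega
  · have h1 := two_mul_mul_le_pow h (by omega : 4 ≤ K + q)
    have h2 : d * (2 * (d * (K + q))) ≤ d * (K + q) ^ d := Nat.mul_le_mul_left _ h1
    have h3 : 2 * (d * (K + q)) ≤ d * (d * (K + q)) := Nat.mul_le_mul_right _ h
    have h4 : 2 * (K + q) ≤ d * (K + q) := Nat.mul_le_mul_right _ h
    have h5 : d * 4 ≤ d * (K + q) := Nat.mul_le_mul_left _ (by omega)
    have h6 : 4 * d * (K + q) ^ d = 4 * (d * (K + q) ^ d) := by ring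
    have h7 : d * (2 * (d * (K + q))) = 2 * (d * (d * (K + q))) := by ring
    omega

theorem weight_budget {d q K p M : ℕ} (hd : 0 < d) (hq : 2 ≤ q) (hK : 2 ≤ K) (hp : 0 < p) :
    28 * K + 36 * (q + 2 * M + q + 1) * (d + 1) + 36 * (q - 1) * (d * (K + q)) +
        36 * ((K + q) ^ d * d) + 72 * ((K + q) ^ d * (d - 1)) + 4 * (p * (K + q) ^ d) ≤
      p * (K + q) ^ d * (60 * M + 38 + 20 * d ^ 2 + 144 * d * q + 8 * d) := by
  set X := K + q with hX
  have hX4 : 4 ≤ X := by omega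
  have hKX : K ≤ X := by omega
  obtain ⟨r, rfl⟩ : ∃ r, q = r + 1 := ⟨q - 1, by omega⟩
  obtain ⟨p, rfl⟩ : ∃ r, p = r + 1 := ⟨p - 1, by omega⟩
  rw [Nat.add_sub_cancel]
  clear_value X
  rcases Nat.lt_or_ge d 2 with h | h
  · obtain rfl : d = 1 := by omega
    simp only [pow_one, one_mul, mul_one, Nat.sub_self, mul_zero]
    have h1 : 4 * (M + r) ≤ X * (M + r) := Nat.mul_le_mul_right _ hX4
    have h2 : 0 ≤ p * X * (60 * M + 62 + 144 * r) := Nat.zero_le _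
    nlinarith
  · obtain ⟨e, rfl⟩ : ∃ e, d = e + 2 := ⟨d - 2, by omega⟩
    have h1 := two_mul_mul_le_pow h hX4
    rw [show e + 2 - 1 = e + 1 by omega]
    generalize X ^ (e + 2) = Z at h1 ⊢
    have h2 : 4 * (e + 2) ≤ (e + 2) * X := by nlinarith
    have h3 : 2 * X ≤ (e + 2) * X := by nlinarith
    have h4 : 8 * (e + 2) ≤ Z := by linarith
    have h5 : (r + M) * (8 * (e + 2)) ≤ (r + M) * Z := Nat.mul_le_mul_left _ h4
    have h6 : r * (2 * ((e + 2) * X)) ≤ r * Z := Nat.mul_le_mul_left _ h1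
    have h7 : 0 ≤ p * Z * (60 * M + 34 + 20 * (e + 2) ^ 2 + 144 * (e + 2) * (r + 1) + 8 * (e + 2)) :=
      Nat.zero_le _
    have h8 : (r + M) * 12 ≤ (r + M) * (8 * (e + 2)) := Nat.mul_le_mul_left _ (by omega)
    nlinarith [Nat.zero_le (Z * e * r), Nat.zero_le (Z * e * e)]

theorem three_le_ceil {d q : ℕ} (hd : 0 < d) (hq : 2 ≤ q) (a : ℝ) :
    3 ≤ max ⌈max (Real.logb 2 (2 * (d : ℝ) * (q : ℝ) + (d : ℝ))) a⌉₊ 1 := by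
  refine le_max_of_le_left (Nat.lt_ceil.2 (lt_max_of_lt_left ?_))
  have hd' : (1 : ℝ) ≤ d := by exact_mod_cast hd
  have hq' : (2 : ℝ) ≤ q := by exact_mod_cast hq
  rw [Real.lt_logb_iff_rpow_lt one_lt_two (by positivity)]
  norm_num
  nlinarith

theorem le_two_pow_of_loglog2_le {H : ℝ} {M : ℕ} (h : loglog2 H ≤ M) : H ≤ 2 ^ 2 ^ M := by
  unfold loglog2 at h
  split_ifs at h with hH
  · calc H ≤ 2 ^ 1 := by simpa using hH
      _ ≤ 2 ^ 2 ^ M := pow_le_pow_right₀ one_le_two Nat.one_le_two_pow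
  · push Not at hH
    have h1 : 0 < Real.logb 2 H := Real.logb_pos one_lt_two (by linarith)
    rw [Real.logb_le_iff_le_rpow one_lt_two h1, Real.rpow_natCast,
      Real.logb_le_iff_le_rpow one_lt_two (by linarith)] at h
    exact_mod_cast h

end SplineApprox

open SplineApprox

theorem statement0 (β : ℝ) (hβ : 2 < β) (p d : ℕ) (hp : 0 < p) (hd : 0 < d)
    (H : ℝ) (hH : 0 < H) (f : (Fin d → ℝ) → Fin p → ℝ)
    (hf : MemHolderBall p β H f) (K : ℕ) (hK : 2 ≤ K) :
    ∃ N : ReQUNet,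
      N.arch 0 = d ∧ N.arch (N.L + 1) = p ∧
      N.width ≤ max (4 * d * (K + lfloor β) ^ d) (max (12 * (K + 2 * lfloor β + 1)) p) ∧
      N.L = 6 + 2 * (lfloor β - 2) + Nat.clog 2 d +
        2 * max ⌈max (Real.logb 2 (2 * (d : ℝ) * (lfloor β : ℝ) + (d : ℝ))) (loglog2 H)⌉₊ 1 ∧
      N.weightsIn (Set.Icc (-1) 1) ∧
      N.numNonzero ≤ p * (K + lfloor β) ^ d *
        (60 * max ⌈max (Real.logb 2 (2 * (d : ℝ) * (lfloor β : ℝ) + (d : ℝ))) (loglog2 H)⌉₊ 1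
          + 38 + 20 * d ^ 2 + 144 * d * lfloor β + 8 * d) ∧
      ∀ ℓ : ℕ, ℓ ≤ lfloor β →
        VHolderNormLe p ℓ (fun x i => f x i - N.evalVec d x (i : ℕ))
          ((Real.sqrt 2 * Real.exp 1 * (d : ℝ)) ^ β * H / (K : ℝ) ^ (β - (ℓ : ℝ)) +
            (9 : ℝ) ^ (d * (lfloor β - 1)) * ((2 * lfloor β + 1 : ℕ) : ℝ) ^ (2 * d + ℓ) *
              (Real.sqrt 2 * Real.exp 1 * (d : ℝ)) ^ β * H / (K : ℝ) ^ (β - (ℓ : ℝ))) := by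
  obtain ⟨hf1, hf2, hf3⟩ := hf
  have hceil : 3 ≤ ⌈β⌉₊ := Nat.lt_ceil.2 (by exact_mod_cast hβ)
  have hq : 2 ≤ lfloor β := by unfold lfloor; omega
  have hcast : ((lfloor β : ℕ) : ℝ) = ⌈β⌉₊ - 1 := by
    rw [lfloor, Nat.cast_sub (by omega), Nat.cast_one]
  have hδ : 0 ≤ β - lfloor β := by
    have := Nat.ceil_lt_add_one (by linarith : 0 ≤ β)
    rw [hcast]; linarith
  have hδ1 : β - lfloor β ≤ 1 := by
    have := Nat.le_ceil β
    rw [hcast]; linarith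
  have hM := three_le_ceil hd hq (loglog2 H)
  have hHM : H ≤ 2 ^ 2 ^ max ⌈max (Real.logb 2 (2 * (d : ℝ) * (lfloor β : ℝ) + (d : ℝ)))
      (loglog2 H)⌉₊ 1 :=
    le_two_pow_of_loglog2_le (((le_max_right _ _).trans (Nat.le_ceil _)).trans
      (by exact_mod_cast le_max_left _ _))
  generalize max ⌈max (Real.logb 2 (2 * (d : ℝ) * (lfloor β : ℝ) + (d : ℝ)))
    (loglog2 H)⌉₊ 1 = M at hM hHM ⊢
  have hspline := fun i => exists_spline_approx (K := K) hd (by omega) (by omega) hH.le hδ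
    (hf1 i) (hf2 i) (hf3 i)
  choose c hc hcapprox using hspline
  obtain ⟨N, h1, h2, h3, h4, h5, h6, h7⟩ := exists_net_splineJet hd hq (by omega) c
    fun i m => coeff_mul_le_amp hd hq hK hM hHM (hc i m)
  refine ⟨N, h2, h3, h4.trans (width_budget hd hq hK), by omega, h5,
    h6.trans (weight_budget hd hq hK hp), fun ℓ hℓ i => ?_⟩
  simp only [h7]
  refine (hcapprox i ℓ hℓ).mono ((splineErr_le hd hq (by omega) hH.le hδ hδ1 (by ring)).trans
    (le_add_of_nonneg_left (by positivity)))
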